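/- arXiv:1711.05493 — 3 statements merged into one kernel-verified Lean document; each statement's English description precedes it below -/
import Mathlib

section
/- Let A and B be real symmetric positive definite n×n matrices whose spectra are contained in an interval [a,b] with 0 < a < b, and let X satisfy the Sylvester equation AX + XB = C where C has rank at most k. Set ρ = exp(π² / (2·log(4b/a))). Then for every ℓ ≥ 1 there exists a matrix M of rank at most k·ℓ such that ‖X − M‖₂ ≤ 4·ρ^(−2ℓ)·‖X‖₂. -/
open Matrix

/-- The spectral norm (operator 2-norm) of a matrix. -/
noncomputable def specNorm {𝕜 : Type*} [RCLike 𝕜] {m n : ℕ}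
    (M : Matrix (Fin m) (Fin n) 𝕜) : ℝ :=
  ‖LinearMap.toContinuousLinearMap (Matrix.toEuclideanLin M)‖

namespace SylvAux
open Real Filter Topology

/-- Real Gaussian theta series. -/
noncomputable def G (T u : ℝ) : ℝ := ∑' n : ℤ, exp (-T * n ^ 2 + 2 * n * u)

theorem jterm (T u : ℝ) (n : ℤ) :
    jacobiTheta₂_term n (-(u / π : ℝ) * Complex.I) ((T / π : ℝ) * Complex.I) =
      ((exp (-T * n ^ 2 + 2 * n * u) : ℝ) : ℂ) := by
  rw [jacobiTheta₂_term, Complex.ofReal_exp]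
  congr 1
  push_cast
  have : (π : ℂ) ≠ 0 := by exact_mod_cast pi_ne_zero
  field_simp
  rw [Complex.I_sq]; ring

theorem im_pos' {T : ℝ} (hT : 0 < T) : 0 < (((T / π : ℝ) : ℂ) * Complex.I).im := by
  rw [Complex.im_ofReal_mul, Complex.I_im, mul_one]; positivity

theorem summable_g {T : ℝ} (hT : 0 < T) (u : ℝ) :
    Summable (fun n : ℤ => exp (-T * n ^ 2 + 2 * n * u)) := by
  have h := (summable_jacobiTheta₂_term_iff (-(u / π : ℝ) * Complex.I)
    ((T / π : ℝ) * Complex.I)).2 (im_pos' hT)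
  simp_rw [jterm] at h
  exact Complex.summable_ofReal.1 h

theorem G_eq {T : ℝ} (u : ℝ) :
    ((G T u : ℝ) : ℂ) = jacobiTheta₂ (-(u / π : ℝ) * Complex.I) ((T / π : ℝ) * Complex.I) := by
  rw [G, Complex.ofReal_tsum, jacobiTheta₂]
  exact tsum_congr fun n => (jterm T u n).symm

theorem G_cont {T : ℝ} (hT : 0 < T) : Continuous (G T) := by
  have h : Continuous (fun u : ℝ => (jacobiTheta₂ (-(u / π : ℝ) * Complex.I)
      ((T / π : ℝ) * Complex.I)).re) := by
    refine Complex.continuous_re.comp ?_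
    rw [continuous_iff_continuousAt]
    intro u
    have := (differentiableAt_jacobiTheta₂_fst (-(u / π : ℝ) * Complex.I) (im_pos' hT)).continuousAt
    exact ContinuousAt.comp (f := fun u : ℝ => (-(u / π : ℝ) * Complex.I : ℂ)) this
      (by fun_prop)
  convert h using 2 with u
  rw [← G_eq, Complex.ofReal_re]

theorem G_pos {T : ℝ} (hT : 0 < T) (u : ℝ) : 0 < G T u :=
  (summable_g hT u).tsum_pos (fun _ => (exp_pos _).le) 0 (exp_pos _)

theorem G_even (T u : ℝ) : G T (-u) = G T u := by
  unfold G
  rw [← (Equiv.neg ℤ).tsum_eq]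
  refine tsum_congr fun n => ?_
  simp

theorem G_quasi (T u : ℝ) : G T (u + T) = exp (T + 2 * u) * G T u := by
  unfold G
  rw [← (Equiv.addRight (1 : ℤ)).tsum_eq, ← tsum_mul_left]
  refine tsum_congr fun n => ?_
  rw [← exp_add]
  congr 1
  simp only [Equiv.coe_addRight]; push_cast; ring

theorem G_half {T : ℝ} (hT : 0 < T) : G T (T / 2) ≤ 2 * G T 0 := by
  have hs := summable_g hT 0
  have hs' := ((Equiv.subRight (1 : ℤ)).summable_iff).2 hs
  have e : G T 0 = ∑' n : ℤ, exp (-T * ((n - 1 : ℤ) : ℝ) ^ 2 + 2 * ((n - 1 : ℤ) : ℝ) * 0) := by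
    unfold G
    rw [← (Equiv.subRight (1 : ℤ)).tsum_eq]; rfl
  rw [two_mul]
  nth_rewrite 2 [e]
  have hadd := hs.tsum_add hs'
  simp only [Function.comp_apply, Equiv.subRight_apply] at hadd
  rw [G, G, ← hadd]
  refine (summable_g hT _).tsum_le_tsum ?_ (hs.add hs')
  intro n
  simp only [mul_zero, add_zero, Function.comp, Equiv.subRight_apply]
  have h1 := exp_pos (-T * (n : ℝ) ^ 2)
  have h2 := exp_pos (-T * ((n - 1 : ℤ) : ℝ) ^ 2)
  rcases le_or_gt n 0 with h | h
  · have : exp (-T * (n : ℝ) ^ 2 + 2 * n * (T / 2)) ≤ exp (-T * (n : ℝ) ^ 2) := by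
      apply exp_le_exp.2
      have : (n : ℝ) ≤ 0 := by exact_mod_cast h
      nlinarith
    linarith
  · have : exp (-T * (n : ℝ) ^ 2 + 2 * n * (T / 2)) ≤ exp (-T * ((n - 1 : ℤ) : ℝ) ^ 2) := by
      apply exp_le_exp.2
      have : (1 : ℝ) ≤ n := by exact_mod_cast h
      push_cast
      nlinarith
    linarith

/-- the uniformizing function -/
noncomputable def xf (T u : ℝ) : ℝ := exp (-u - T / 4) * G T (u + T / 2) / G T u

theorem xf_pos {T : ℝ} (hT : 0 < T) (u : ℝ) : 0 < xf T u := by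
  have := G_pos hT u
  have := G_pos hT (u + T / 2)
  unfold xf; positivity

theorem xf_cont {T : ℝ} (hT : 0 < T) : Continuous (xf T) := by
  unfold xf
  have := G_cont hT
  refine Continuous.div (by fun_prop) this (fun u => (G_pos hT u).ne')

theorem xf_even (T u : ℝ) : xf T (-u) = xf T u := by
  unfold xf
  have h := G_quasi T (u - T / 2)
  rw [show u - T / 2 + T = u + T / 2 by ring] at h
  rw [G_even, h, ← G_even T (-u + T / 2), ← mul_assoc, ← exp_add]
  congr 4 <;> ring

theorem xf_shift {T : ℝ} (hT : 0 < T) (u : ℝ) : xf T (u + T / 2) * xf T u = 1 := by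
  unfold xf
  rw [show u + T / 2 + T / 2 = u + T by ring, G_quasi]
  have h1 := (G_pos hT u).ne'
  have h2 := (G_pos hT (u + T / 2)).ne'
  have : exp (-(u + T / 2) - T / 4) * exp (T + 2 * u) * exp (-u - T / 4) = 1 := by
    rw [← exp_add, ← exp_add, ← exp_zero]; congr 1; ring
  calc _ = (exp (-(u + T / 2) - T / 4) * exp (T + 2 * u) * exp (-u - T / 4)) *
        (G T (u + T / 2) / G T (u + T / 2)) * (G T u / G T u) := by ring
    _ = 1 := by rw [this, div_self h1, div_self h2]; simp

theorem xf_zero_le {T : ℝ} (hT : 0 < T) : xf T 0 ≤ 2 * exp (-T / 4) := by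
  unfold xf
  rw [div_le_iff₀ (G_pos hT 0), zero_add, show -0 - T / 4 = -T / 4 by ring]
  nlinarith [G_half hT, exp_pos (-T / 4)]

theorem xf_quarter {T : ℝ} (hT : 0 < T) : xf T (T / 4) = 1 := by
  have h := xf_shift hT (-(T / 4))
  rw [show -(T / 4) + T / 2 = T / 4 by ring, xf_even] at h
  nlinarith [xf_pos hT (T / 4)]

/-- Signed theta series in triple product normalization -/
noncomputable def Th (s T w : ℝ) : ℝ := ∑' n : ℤ, s ^ n * exp (-T * (n * (n - 1)) / 2 + n * w)

theorem th_exp (T w : ℝ) (n : ℤ) : exp (-T * (n * (n - 1)) / 2 + n * w) =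
    exp (-(T / 2) * n ^ 2 + 2 * n * (w / 2 + T / 4)) := by
  congr 1; ring

theorem abs_zpow_one {s : ℝ} (hs : |s| = 1) (n : ℤ) : |s ^ n| = 1 := by
  rw [abs_zpow, hs, _root_.one_zpow]

theorem summable_th0 {T : ℝ} (hT : 0 < T) (w : ℝ) :
    Summable (fun n : ℤ => exp (-T * (n * (n - 1)) / 2 + n * w)) := by
  simp_rw [th_exp]
  exact summable_g (by positivity) _

theorem summable_th {s T : ℝ} (hs : |s| = 1) (hT : 0 < T) (w : ℝ) :
    Summable (fun n : ℤ => s ^ n * exp (-T * (n * (n - 1)) / 2 + n * w)) := by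
  refine (summable_th0 hT w).of_norm_bounded ?_
  intro n
  rw [norm_mul, norm_eq_abs, abs_zpow_one hs, one_mul, norm_eq_abs, abs_exp]

theorem Th_pos {T : ℝ} (hT : 0 < T) (w : ℝ) : 0 < Th 1 T w := by
  unfold Th
  simp only [_root_.one_zpow, one_mul]
  exact (summable_th0 hT w).tsum_pos (fun _ => (exp_pos _).le) 0 (exp_pos _)

/-- parity splitting of `ℤ × ℤ` -/
theorem bij_split : Function.Bijective (Sum.elim (fun p : ℤ × ℤ => (p.1 + p.2, p.1 - p.2))
    (fun p : ℤ × ℤ => (p.1 + p.2, p.1 - p.2 + 1))) := by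
  constructor
  · rintro (⟨a, b⟩ | ⟨a, b⟩) (⟨c, d⟩ | ⟨c, d⟩) h <;>
      simp only [Sum.elim_inl, Sum.elim_inr, Prod.mk.injEq] at h
    · congr 2 <;> omega
    · omega
    · omega
    · congr 2 <;> omega
  · rintro ⟨n, m⟩
    rcases Int.even_or_odd (n - m) with ⟨r, hr⟩ | ⟨r, hr⟩
    · exact ⟨Sum.inl (n - r, r), by simp; omega⟩
    · exact ⟨Sum.inr (n - (r + 1), r + 1), by simp; omega⟩

theorem hasSum_cg {ι : Type*} {f g : ι → ℝ} {a b : ℝ} (h : HasSum f a) (h1 : g = f) (h2 : b = a) :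
    HasSum g b := by
  subst h1; subst h2; exact h

theorem Th_mul {s T : ℝ} (hs : s = 1 ∨ s = -1) (hT : 0 < T) (u v : ℝ) :
    Th s T (u + v) * Th s T (u - v) = exp (T / 4 + u) *
      (exp (-u - T / 4) * G T (u + T / 2) * G T v + s * (G T u * (exp (-v - T / 4) * G T (v + T / 2)))) := by
  have hs1 : |s| = 1 := by rcases hs with rfl | rfl <;> simp
  have hs0 : s ≠ 0 := by rcases hs with rfl | rfl <;> simp
  have hss : s * s = 1 := by rcases hs with rfl | rfl <;> simp
  have hss' : ∀ n : ℤ, s ^ (n + n) = 1 := by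
    intro n; rw [zpow_add₀ hs0, ← mul_zpow, hss, _root_.one_zpow]
  have A := summable_th hs1 hT (u + v)
  have B := summable_th hs1 hT (u - v)
  have hsum := summable_mul_of_summable_norm A.norm B.norm
  unfold Th
  rw [tsum_mul_tsum_of_summable_norm A.norm B.norm]
  let e := Equiv.ofBijective _ bij_split
  have key : ∀ p q : ℝ, HasSum (fun z : ℤ × ℤ => exp (-T * z.1 ^ 2 + 2 * z.1 * p) *
      exp (-T * z.2 ^ 2 + 2 * z.2 * q)) (G T p * G T q) := by
    intro p q
    have hp := (summable_g hT p).norm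
    have hq := (summable_g hT q).norm
    have h := (summable_mul_of_summable_norm hp hq).hasSum
    rwa [← tsum_mul_tsum_of_summable_norm hp hq] at h
  rw [← e.tsum_eq]
  refine HasSum.tsum_eq ?_
  rw [mul_add]
  refine HasSum.sum ?_ ?_
  · refine hasSum_cg ((key (u + T / 2) v).mul_left (exp (T / 4 + u) * exp (-u - T / 4))) ?_ ?_
    · funext ⟨α, γ⟩
      simp only [e, Function.comp_apply, Equiv.ofBijective_apply, Sum.elim_inl]
      have h1 : s ^ (α + γ) * s ^ (α - γ) = 1 := by
        rw [← zpow_add₀ hs0, show α + γ + (α - γ) = α + α by ring, hss']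
      have h2 : exp (-T * (((α + γ : ℤ) : ℝ) * (((α + γ : ℤ) : ℝ) - 1)) / 2 + ((α + γ : ℤ) : ℝ) * (u + v)) *
          exp (-T * (((α - γ : ℤ) : ℝ) * (((α - γ : ℤ) : ℝ) - 1)) / 2 + ((α - γ : ℤ) : ℝ) * (u - v)) =
          exp (T / 4 + u) * exp (-u - T / 4) * (exp (-T * (α : ℝ) ^ 2 + 2 * α * (u + T / 2)) *
          exp (-T * (γ : ℝ) ^ 2 + 2 * γ * v)) := by
        simp only [← exp_add]
        congr 1; push_cast; ring
      rw [← h2]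
      linear_combination (exp (-T * (((α + γ : ℤ) : ℝ) * (((α + γ : ℤ) : ℝ) - 1)) / 2 + ((α + γ : ℤ) : ℝ) * (u + v)) *
          exp (-T * (((α - γ : ℤ) : ℝ) * (((α - γ : ℤ) : ℝ) - 1)) / 2 + ((α - γ : ℤ) : ℝ) * (u - v))) * h1
    · ring
  · refine hasSum_cg ((key u (v + T / 2)).mul_left (s * (exp (T / 4 + u) * exp (-v - T / 4)))) ?_ ?_
    · funext ⟨α, γ⟩
      simp only [e, Function.comp_apply, Equiv.ofBijective_apply, Sum.elim_inr]
      have h1 : s ^ (α + γ) * s ^ (α - γ + 1) = s := by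
        rw [← zpow_add₀ hs0, show α + γ + (α - γ + 1) = α + α + 1 by ring, zpow_add₀ hs0, hss']
        simp
      have h2 : exp (-T * (((α + γ : ℤ) : ℝ) * (((α + γ : ℤ) : ℝ) - 1)) / 2 + ((α + γ : ℤ) : ℝ) * (u + v)) *
          exp (-T * (((α - γ + 1 : ℤ) : ℝ) * (((α - γ + 1 : ℤ) : ℝ) - 1)) / 2 + ((α - γ + 1 : ℤ) : ℝ) * (u - v)) =
          exp (T / 4 + u) * exp (-v - T / 4) * (exp (-T * (α : ℝ) ^ 2 + 2 * α * u) *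
          exp (-T * (γ : ℝ) ^ 2 + 2 * γ * (v + T / 2))) := by
        simp only [← exp_add]
        congr 1; push_cast; ring
      rw [mul_assoc s, ← h2]
      linear_combination (exp (-T * (((α + γ : ℤ) : ℝ) * (((α + γ : ℤ) : ℝ) - 1)) / 2 + ((α + γ : ℤ) : ℝ) * (u + v)) *
          exp (-T * (((α - γ + 1 : ℤ) : ℝ) * (((α - γ + 1 : ℤ) : ℝ) - 1)) / 2 + ((α - γ + 1 : ℤ) : ℝ) * (u - v))) * h1
    · ring

/-- theta quotient -/
noncomputable def ph (T w : ℝ) : ℝ := Th (-1) T w / Th 1 T w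

theorem ph_mul {T : ℝ} (hT : 0 < T) (u v : ℝ) :
    ph T (u + v) * ph T (u - v) = (xf T u - xf T v) / (xf T u + xf T v) := by
  unfold ph
  rw [div_mul_div_comm, Th_mul (Or.inr rfl) hT, Th_mul (Or.inl rfl) hT, mul_div_mul_left _ _ (exp_pos _).ne']
  have h1 := G_pos hT u
  have h2 := G_pos hT v
  have h3 := G_pos hT (u + T / 2)
  have h4 := G_pos hT (v + T / 2)
  have e1 : exp (-u - T / 4) * G T (u + T / 2) = xf T u * G T u := by
    unfold xf; field_simp
  have e2 : exp (-v - T / 4) * G T (v + T / 2) = xf T v * G T v := by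
    unfold xf; field_simp
  rw [e1, e2]
  have h5 := xf_pos hT u
  have h6 := xf_pos hT v
  rw [div_eq_div_iff (by positivity) (by positivity)]
  ring

theorem xf_zero_min {T : ℝ} (hT : 0 < T) (u : ℝ) : xf T 0 ≤ xf T u := by
  have h := ph_mul hT u 0
  rw [add_zero, sub_zero] at h
  by_contra hc
  push Not at hc
  have : (xf T u - xf T 0) / (xf T u + xf T 0) < 0 :=
    div_neg_of_neg_of_pos (by linarith) (add_pos (xf_pos hT _) (xf_pos hT _))
  nlinarith [mul_self_nonneg (ph T u)]

theorem xf_max {T : ℝ} (hT : 0 < T) (u : ℝ) : xf T u ≤ (xf T 0)⁻¹ := by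
  have h := xf_shift hT u
  have h1 := xf_zero_min hT (u + T / 2)
  have h0 := xf_pos hT 0
  rw [← one_div, le_div_iff₀ h0]
  nlinarith [xf_pos hT u]

/-- Value at the half period via Poisson summation -/
theorem Th_poisson {T : ℝ} (hT : 0 < T) :
    ph T (-(T / 2)) = xf (2 * π ^ 2 / T) 0 := by
  have ha : 0 < (((T / (2 * π) : ℝ) : ℂ)).re := by
    rw [Complex.ofReal_re]; positivity
  have hpi : (π : ℂ) ≠ 0 := by exact_mod_cast pi_ne_zero
  have hTc : (T : ℂ) ≠ 0 := by exact_mod_cast hT.ne'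
  have P0 := Complex.tsum_exp_neg_quadratic ha 0
  have P1 := Complex.tsum_exp_neg_quadratic ha (Complex.I / 2)
  have ha0 : (1 / (((T / (2 * π) : ℝ) : ℂ)) ^ (1 / 2 : ℂ)) ≠ 0 := by
    have : (((T / (2 * π) : ℝ) : ℂ)) ≠ 0 := by
      have : T / (2 * π) ≠ 0 := by positivity
      exact_mod_cast this
    simp [Complex.cpow_eq_zero_iff, hTc]
  have L0 : (∑' n : ℤ, Complex.exp (-π * ((T / (2 * π) : ℝ) : ℂ) * n ^ 2 + 2 * π * 0 * n)) =
      ((Th 1 T (-(T / 2)) : ℝ) : ℂ) := by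
    rw [Th, Complex.ofReal_tsum]
    refine tsum_congr fun n => ?_
    rw [_root_.one_zpow, one_mul, Complex.ofReal_exp]
    congr 1; push_cast; field_simp; ring
  have L1 : (∑' n : ℤ, Complex.exp (-π * ((T / (2 * π) : ℝ) : ℂ) * n ^ 2 + 2 * π * (Complex.I / 2) * n)) =
      ((Th (-1) T (-(T / 2)) : ℝ) : ℂ) := by
    rw [Th, Complex.ofReal_tsum]
    refine tsum_congr fun n => ?_
    rw [Complex.ofReal_mul, Complex.ofReal_exp, Complex.ofReal_zpow, Complex.ofReal_neg, Complex.ofReal_one,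
      ← Complex.exp_pi_mul_I, ← Complex.exp_int_mul, ← Complex.exp_add]
    congr 1; push_cast; field_simp; ring
  have R0 : (∑' n : ℤ, Complex.exp (-π / ((T / (2 * π) : ℝ) : ℂ) * (n + Complex.I * 0) ^ 2)) =
      ((G (2 * π ^ 2 / T) 0 : ℝ) : ℂ) := by
    rw [G, Complex.ofReal_tsum]
    refine tsum_congr fun n => ?_
    rw [Complex.ofReal_exp]
    congr 1; push_cast; field_simp; ring
  have R1 : (∑' n : ℤ, Complex.exp (-π / ((T / (2 * π) : ℝ) : ℂ) * (n + Complex.I * (Complex.I / 2)) ^ 2)) =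
      ((exp (-0 - (2 * π ^ 2 / T) / 4) * G (2 * π ^ 2 / T) (0 + (2 * π ^ 2 / T) / 2) : ℝ) : ℂ) := by
    rw [G, ← tsum_mul_left, Complex.ofReal_tsum]
    refine tsum_congr fun n => ?_
    rw [← exp_add, Complex.ofReal_exp]
    congr 1; push_cast
    rw [show (n : ℂ) + Complex.I * (Complex.I / 2) = n - 1 / 2 by
      linear_combination (1 / 2 : ℂ) * Complex.I_mul_I]
    field_simp; ring
  rw [L0, R0] at P0
  rw [L1, R1] at P1
  have hc : ((ph T (-(T / 2)) : ℝ) : ℂ) = ((xf (2 * π ^ 2 / T) 0 : ℝ) : ℂ) := by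
    rw [ph, xf, Complex.ofReal_div, Complex.ofReal_div, P0, P1, mul_div_mul_left _ _ ha0]
  exact_mod_cast hc
theorem sum_shift (N : ℕ) (f : ℤ → ℝ) (hf : ∀ n : ℤ, N < n.natAbs → f n = 0) :
    ∑' n : ℤ, f n = ∑ j ∈ Finset.range (2 * N + 1), f ((j : ℤ) - N) := by
  rw [tsum_eq_sum (s := (Finset.range (2 * N + 1)).image (fun j : ℕ => (j : ℤ) - N))]
  · rw [Finset.sum_image]
    intro a _ b _ h
    simp only at h
    omega
  · intro n hn
    apply hf
    by_contra hc
    apply hn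
    rw [Finset.mem_image]
    exact ⟨(n + N).toNat, by rw [Finset.mem_range]; omega, by omega⟩

/-- `q`-Pochhammer -/
noncomputable def Qf (q : ℝ) (m : ℕ) : ℝ := ∏ i ∈ Finset.range m, (1 - q ^ (i + 1))

/-- Gaussian binomials -/
noncomputable def gb (q : ℝ) : ℕ → ℕ → ℝ
  | _, 0 => 1
  | 0, _ + 1 => 0
  | m + 1, j + 1 => q ^ (j + 1) * gb q m (j + 1) + gb q m j

theorem gb_zero_right (q : ℝ) (m : ℕ) : gb q m 0 = 1 := by
  cases m <;> simp [gb]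

theorem gb_eq_zero (q : ℝ) : ∀ m j : ℕ, m < j → gb q m j = 0 := by
  intro m
  induction m with
  | zero => intro j hj; obtain ⟨i, rfl⟩ := Nat.exists_eq_succ_of_ne_zero (by omega : j ≠ 0); simp [gb]
  | succ m ih =>
    intro j hj
    obtain ⟨i, rfl⟩ := Nat.exists_eq_succ_of_ne_zero (by omega : j ≠ 0)
    simp only [Nat.succ_eq_add_one, gb]
    rw [ih _ (by omega), ih _ (by omega)]; simp

theorem gb_self (q : ℝ) (m : ℕ) : gb q m m = 1 := by
  induction m with
  | zero => simp [gb]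
  | succ m ih => rw [gb, gb_eq_zero q m (m + 1) (by omega), ih]; simp

theorem Qf_succ (q : ℝ) (m : ℕ) : Qf q (m + 1) = Qf q m * (1 - q ^ (m + 1)) := by
  rw [Qf, Finset.prod_range_succ]; rfl

theorem gb_closed (q : ℝ) : ∀ s i j : ℕ, i + j = s → gb q (i + j) i * (Qf q i * Qf q j) = Qf q (i + j) := by
  intro s
  induction s with
  | zero => intro i j h; obtain ⟨rfl, rfl⟩ : i = 0 ∧ j = 0 := by omega
            simp [gb, Qf]
  | succ s ih =>
    intro i j h
    rcases i with _ | i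
    · rw [gb_zero_right]; simp [Qf]
    rcases j with _ | j
    · rw [add_zero, gb_self]; simp [Qf]
    have h1 := ih (i + 1) j (by omega)
    have h2 := ih i (j + 1) (by omega)
    rw [show i + 1 + j = i + j + 1 by ring] at h1
    rw [show i + (j + 1) = i + j + 1 by ring] at h2
    rw [show i + 1 + (j + 1) = (i + j + 1) + 1 by ring, gb, Qf_succ q (i + j + 1), Qf_succ q j]
    rw [Qf_succ q j] at h2
    calc _ = q ^ (i + 1) * (1 - q ^ (j + 1)) * (gb q (i + j + 1) (i + 1) * (Qf q (i + 1) * Qf q j))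
          + (gb q (i + j + 1) i * (Qf q i * (Qf q j * (1 - q ^ (j + 1))))) * (1 - q ^ (i + 1)) := by
            rw [Qf_succ q i]; ring
      _ = _ := by rw [h1, h2]; ring

theorem qbinom (q : ℝ) (m : ℕ) : ∀ y : ℝ, ∏ k ∈ Finset.range m, (1 + q ^ k * y) =
    ∑ j ∈ Finset.range (m + 1), q ^ (j.choose 2) * gb q m j * y ^ j := by
  induction m with
  | zero => intro y; simp [gb]
  | succ m ih =>
    intro y
    rw [Finset.prod_range_succ']
    have h := ih (q * y)
    have e : ∏ k ∈ Finset.range m, (1 + q ^ (k + 1) * y) = ∏ k ∈ Finset.range m, (1 + q ^ k * (q * y)) :=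
      Finset.prod_congr rfl fun k _ => by ring
    rw [e, h, Finset.sum_range_succ' _ (m + 1)]
    have e2 : ∀ j ∈ Finset.range (m + 1), q ^ ((j + 1).choose 2) * gb q (m + 1) (j + 1) * y ^ (j + 1) =
        q ^ ((j + 1).choose 2) * gb q m (j + 1) * (q * y) ^ (j + 1) +
        y * (q ^ (j.choose 2) * gb q m j * (q * y) ^ j) := by
      intro j _
      have : (j + 1).choose 2 = j + j.choose 2 := by
        rw [Nat.choose_succ_succ' j 1, Nat.choose_one_right]
      rw [this, gb]; ring
    rw [Finset.sum_congr rfl e2, Finset.sum_add_distrib, ← Finset.mul_sum]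
    have e3 : ∑ j ∈ Finset.range (m + 1), q ^ ((j + 1).choose 2) * gb q m (j + 1) * (q * y) ^ (j + 1) =
        (∑ j ∈ Finset.range (m + 1), q ^ (j.choose 2) * gb q m j * (q * y) ^ j) - 1 := by
      have a1 := Finset.sum_range_succ' (fun j => q ^ (j.choose 2) * gb q m j * (q * y) ^ j) (m + 1)
      have a2 := Finset.sum_range_succ (fun j => q ^ (j.choose 2) * gb q m j * (q * y) ^ j) (m + 1)
      rw [gb_eq_zero q m (m + 1) (by omega)] at a2
      simp only [gb_zero_right] at a1
      simp only [Nat.choose_zero_succ, pow_zero, mul_one, mul_zero, zero_mul, add_zero] at a1 a2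
      linarith
    rw [e3]
    simp [gb_zero_right]
    ring

/-- partial triple product -/
noncomputable def PN (s : ℝ) (N : ℕ) (T w : ℝ) : ℝ :=
  (∏ k ∈ Finset.range N, (1 + s * exp (w - k * T))) *
    ∏ k ∈ Finset.range N, (1 + s * exp (-w - (k + 1) * T))

theorem PN_eq {s : ℝ} (hs : s = 1 ∨ s = -1) (N : ℕ) (T w : ℝ) :
    PN s N T w = ∑ j ∈ Finset.range (2 * N + 1), gb (exp (-T)) (2 * N) j *
      (s ^ ((j : ℤ) - N) * exp (-T * ((((j : ℤ) - N : ℤ) : ℝ) * ((((j : ℤ) - N : ℤ) : ℝ) - 1)) / 2 +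
        (((j : ℤ) - N : ℤ) : ℝ) * w)) := by
  have hs0 : s ≠ 0 := by rcases hs with rfl | rfl <;> simp
  have hss : s * s = 1 := by rcases hs with rfl | rfl <;> simp
  have hq : ∀ k : ℕ, exp (-T) ^ k = exp (-(k * T)) := by
    intro k; rw [← exp_nat_mul]; congr 1; ring
  have hb := qbinom (exp (-T)) (2 * N) (s * exp (w + N * T))
  have hD : ∀ N : ℕ, ∏ i ∈ Finset.range N, (s * exp (w + (i + 1) * T)) =
      s ^ N * exp (N * w + T * (N * (N + 1)) / 2) := by
    intro N
    induction N with
    | zero => simp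
    | succ N ih =>
      rw [Finset.prod_range_succ, ih, pow_succ]
      have : exp (((N + 1 : ℕ) : ℝ) * w + T * (((N + 1 : ℕ) : ℝ) * (((N + 1 : ℕ) : ℝ) + 1)) / 2) =
          exp (N * w + T * (N * (N + 1)) / 2) * exp (w + (N + 1) * T) := by
        rw [← exp_add]; congr 1; push_cast; ring
      rw [this]; ring
  have hfac : ∏ k ∈ Finset.range (2 * N), (1 + exp (-T) ^ k * (s * exp (w + N * T))) =
      (s ^ N * exp (N * w + T * (N * (N + 1)) / 2)) * PN s N T w := by
    rw [two_mul, Finset.prod_range_add, ← hD, PN, ← Finset.prod_range_reflect]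
    have h1 : ∀ j ∈ Finset.range N, (1 + exp (-T) ^ (N - 1 - j) * (s * exp (w + N * T))) =
        (s * exp (w + (j + 1) * T)) * (1 + s * exp (-w - (j + 1) * T)) := by
      intro j hj
      have hj' := Finset.mem_range.1 hj
      have hc : ((N - 1 - j : ℕ) : ℝ) = N - 1 - j := by
        rw [Nat.cast_sub (by omega), Nat.cast_sub (by omega)]; simp
      have a1 : exp (-T) ^ (N - 1 - j) * exp (w + N * T) = exp (w + (j + 1) * T) := by
        rw [hq, ← exp_add, hc]; congr 1; ring
      have a2 : exp (w + (j + 1) * T) * exp (-w - (j + 1) * T) = 1 := by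
        rw [← exp_add, ← exp_zero]; congr 1; ring
      linear_combination s * a1 - s * s * a2 - hss
    have h2 : ∀ j ∈ Finset.range N, (1 + exp (-T) ^ (N + j) * (s * exp (w + N * T))) =
        (1 + s * exp (w - j * T)) := by
      intro j hj
      have a1 : exp (-T) ^ (N + j) * exp (w + N * T) = exp (w - j * T) := by
        rw [hq, ← exp_add]; congr 1; push_cast; ring
      linear_combination s * a1
    rw [Finset.prod_congr rfl h1, Finset.prod_congr rfl h2, Finset.prod_mul_distrib]
    ring
  rw [hfac] at hb
  have hDne : s ^ N * exp (N * w + T * (N * (N + 1)) / 2) ≠ 0 :=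
    mul_ne_zero (pow_ne_zero _ hs0) (exp_pos _).ne'
  apply mul_left_cancel₀ hDne
  rw [hb, Finset.mul_sum]
  refine Finset.sum_congr rfl fun j _ => ?_
  have b1 : s ^ N * s ^ ((j : ℤ) - N) = s ^ j := by
    rw [← zpow_natCast, ← zpow_add₀ hs0, ← zpow_natCast]; congr 1; ring
  have b2 : exp (-T) ^ (j.choose 2) * exp (w + N * T) ^ j = exp (N * w + T * (N * (N + 1)) / 2) *
      exp (-T * ((((j : ℤ) - N : ℤ) : ℝ) * ((((j : ℤ) - N : ℤ) : ℝ) - 1)) / 2 +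
        (((j : ℤ) - N : ℤ) : ℝ) * w) := by
    rw [hq, ← exp_nat_mul, ← exp_add, ← exp_add, Nat.cast_choose_two]
    congr 1; push_cast; ring
  rw [mul_pow, ← b1]
  linear_combination (s ^ N * s ^ ((j : ℤ) - N) * gb (exp (-T)) (2 * N) j) * b2

/-- normalized coefficients -/
noncomputable def cN (q : ℝ) (N : ℕ) (n : ℤ) : ℝ :=
  if n.natAbs ≤ N then Qf q N * Qf q N / (Qf q (N + n.natAbs) * Qf q (N - n.natAbs)) else 0

theorem Qf_pos {q : ℝ} (h0 : 0 < q) (h1 : q < 1) (m : ℕ) : 0 < Qf q m := by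
  refine Finset.prod_pos fun i _ => ?_
  have := pow_lt_one₀ h0.le h1 (Nat.succ_ne_zero i)
  simpa using this

theorem gb_cN {q : ℝ} (h0 : 0 < q) (h1 : q < 1) (N j : ℕ) (hj : j ≤ 2 * N) :
    Qf q N * Qf q N / Qf q (2 * N) * gb q (2 * N) j = cN q N ((j : ℤ) - N) := by
  have h := gb_closed q (2 * N) j (2 * N - j) (by omega)
  rw [show j + (2 * N - j) = 2 * N by omega] at h
  have p1 := Qf_pos h0 h1 j
  have p2 := Qf_pos h0 h1 (2 * N - j)
  have p3 := Qf_pos h0 h1 (2 * N)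
  have hc : cN q N ((j : ℤ) - N) = Qf q N * Qf q N / (Qf q j * Qf q (2 * N - j)) := by
    unfold cN
    rw [if_pos (by omega)]
    rcases le_total N j with hl | hl
    · rw [show N + ((j : ℤ) - N).natAbs = j by omega, show N - ((j : ℤ) - N).natAbs = 2 * N - j by omega]
    · rw [show N + ((j : ℤ) - N).natAbs = 2 * N - j by omega, show N - ((j : ℤ) - N).natAbs = j by omega,
        mul_comm (Qf q j)]
  rw [hc, ← h]
  have : gb q (2 * N) j ≠ 0 := by
    intro h'; rw [h', zero_mul] at h; exact p3.ne h
  field_simp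

theorem Qf_add (q : ℝ) (M m : ℕ) : Qf q (M + m) = Qf q M * ∏ i ∈ Finset.range m, (1 - q ^ (M + i + 1)) := by
  rw [Qf, Finset.prod_range_add]; rfl

theorem cN_shift {q : ℝ} (h0 : 0 < q) (h1 : q < 1) (M : ℕ) (n : ℤ) :
    cN q (M + n.natAbs) n = (∏ i ∈ Finset.range n.natAbs, (1 - q ^ (M + i + 1))) /
      ∏ i ∈ Finset.range n.natAbs, (1 - q ^ (M + n.natAbs + i + 1)) := by
  unfold cN
  rw [if_pos (by omega), Nat.add_sub_cancel, Qf_add q (M + n.natAbs)]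
  have p1 := Qf_pos h0 h1 M
  have p2 := Qf_pos h0 h1 (M + n.natAbs)
  rw [show Qf q (M + n.natAbs) * Qf q (M + n.natAbs) = Qf q (M + n.natAbs) *
    (Qf q M * ∏ i ∈ Finset.range n.natAbs, (1 - q ^ (M + i + 1))) by rw [← Qf_add]]
  rw [mul_assoc, mul_div_mul_left _ _ p2.ne', mul_comm _ (Qf q M), mul_div_mul_left _ _ p1.ne']

theorem fac_pos {q : ℝ} (h0 : 0 < q) (h1 : q < 1) (a : ℕ) : 0 < 1 - q ^ (a + 1) := by
  have := pow_lt_one₀ h0.le h1 (Nat.succ_ne_zero a)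
  simpa using this

theorem cN_bound {q : ℝ} (h0 : 0 < q) (h1 : q < 1) (N : ℕ) (n : ℤ) : |cN q N n| ≤ 1 := by
  by_cases h : n.natAbs ≤ N
  · obtain ⟨M, rfl⟩ : ∃ M, N = M + n.natAbs := ⟨N - n.natAbs, by omega⟩
    rw [cN_shift h0 h1]
    have p1 : 0 < ∏ i ∈ Finset.range n.natAbs, (1 - q ^ (M + i + 1)) :=
      Finset.prod_pos fun i _ => fac_pos h0 h1 _
    have p2 : 0 < ∏ i ∈ Finset.range n.natAbs, (1 - q ^ (M + n.natAbs + i + 1)) :=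
      Finset.prod_pos fun i _ => fac_pos h0 h1 _
    rw [abs_of_pos (by positivity), div_le_one p2]
    refine Finset.prod_le_prod (fun i _ => (fac_pos h0 h1 _).le) fun i _ => ?_
    have : q ^ (M + n.natAbs + i + 1) ≤ q ^ (M + i + 1) :=
      pow_le_pow_of_le_one h0.le h1.le (by omega)
    linarith
  · simp [cN, h]

theorem cN_tendsto {q : ℝ} (h0 : 0 < q) (h1 : q < 1) (n : ℤ) :
    Tendsto (fun N => cN q N n) atTop (𝓝 1) := by
  rw [← tendsto_add_atTop_iff_nat n.natAbs]
  simp_rw [cN_shift h0 h1]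
  have key : ∀ c : ℕ, Tendsto (fun M : ℕ => ∏ i ∈ Finset.range n.natAbs, (1 - q ^ (M + c + i + 1)))
      atTop (𝓝 1) := by
    intro c
    have : Tendsto (fun M : ℕ => ∏ i ∈ Finset.range n.natAbs, (1 - q ^ (M + c + i + 1)))
      atTop (𝓝 (∏ i ∈ Finset.range n.natAbs, (1 - 0))) := by
      refine tendsto_finsetProd _ fun i _ => tendsto_const_nhds.sub ?_
      have := (tendsto_add_atTop_iff_nat (c + i + 1)).2 (tendsto_pow_atTop_nhds_zero_of_lt_one h0.le h1)
      simpa only [add_assoc] using this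
    simpa using this
  have := (key 0).div (key n.natAbs) one_ne_zero
  simp only [add_zero, div_one] at this
  exact this

theorem PN_tendsto {s T : ℝ} (hs : s = 1 ∨ s = -1) (hT : 0 < T) (w : ℝ) :
    Tendsto (fun N => Qf (exp (-T)) N * Qf (exp (-T)) N / Qf (exp (-T)) (2 * N) * PN s N T w) atTop
      (𝓝 (Th s T w)) := by
  have hs1 : |s| = 1 := by rcases hs with rfl | rfl <;> simp
  have h0 : 0 < exp (-T) := exp_pos _
  have h1 : exp (-T) < 1 := by rw [exp_lt_one_iff]; linarith
  have e : ∀ N, Qf (exp (-T)) N * Qf (exp (-T)) N / Qf (exp (-T)) (2 * N) * PN s N T w =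
      ∑' n : ℤ, cN (exp (-T)) N n * (s ^ n * exp (-T * (n * (n - 1)) / 2 + n * w)) := by
    intro N
    rw [sum_shift N, PN_eq hs, Finset.mul_sum]
    · refine Finset.sum_congr rfl fun j hj => ?_
      rw [← mul_assoc, gb_cN h0 h1 N j (by have := Finset.mem_range.1 hj; omega)]
    · intro n hn
      simp [cN, not_le.2 hn]
  simp_rw [e]
  refine tendsto_tsum_of_dominated_convergence (summable_th0 hT w) ?_ ?_
  · intro n
    have := (cN_tendsto h0 h1 n).mul_const (s ^ n * exp (-T * (n * (n - 1)) / 2 + n * w))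
    simpa using this
  · refine Eventually.of_forall fun N n => ?_
    rw [norm_mul, norm_mul, norm_eq_abs, norm_eq_abs, norm_eq_abs, abs_zpow_one hs1, one_mul, abs_exp]
    have := cN_bound h0 h1 N n
    have := exp_pos (-T * (n * (n - 1)) / 2 + n * w)
    nlinarith

theorem ph_tendsto {T : ℝ} (hT : 0 < T) (w : ℝ) :
    Tendsto (fun N => PN (-1) N T w / PN 1 N T w) atTop (𝓝 (ph T w)) := by
  have h0 : 0 < exp (-T) := exp_pos _
  have h1 : exp (-T) < 1 := by rw [exp_lt_one_iff]; linarith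
  have := (PN_tendsto (Or.inr rfl) hT w).div (PN_tendsto (Or.inl rfl) hT w) (Th_pos hT w).ne'
  refine this.congr fun N => ?_
  have p1 := Qf_pos h0 h1 N
  have p2 := Qf_pos h0 h1 (2 * N)
  exact mul_div_mul_left _ _ (by positivity)

theorem prod_block (f : ℕ → ℝ) (L N : ℕ) :
    ∏ i ∈ Finset.range L, ∏ k ∈ Finset.range N, f (k * L + i) = ∏ j ∈ Finset.range (L * N), f j := by
  rw [Finset.prod_comm]
  induction N with
  | zero => simp
  | succ N ih =>
    rw [Finset.prod_range_succ, ih, Nat.mul_succ, Finset.prod_range_add, mul_comm N L]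

theorem PN_block (s : ℝ) (L N : ℕ) (h w : ℝ) :
    ∏ i ∈ Finset.range L, PN s N (L * h) (w - i * h) = PN s (L * N) h w := by
  unfold PN
  rw [Finset.prod_mul_distrib, ← prod_block, ← prod_block]
  congr 1
  · refine Finset.prod_congr rfl fun i _ => Finset.prod_congr rfl fun k _ => ?_
    congr 3; push_cast; ring
  · rw [← Finset.prod_range_reflect]
    refine Finset.prod_congr rfl fun i hi => Finset.prod_congr rfl fun k _ => ?_
    have hi' := Finset.mem_range.1 hi
    have hc : ((L - 1 - i : ℕ) : ℝ) = L - 1 - i := by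
      rw [Nat.cast_sub (by omega), Nat.cast_sub (by omega)]; simp
    rw [hc]
    congr 3; push_cast; ring

theorem ph_block {L : ℕ} (hL : 0 < L) {h : ℝ} (hh : 0 < h) (w : ℝ) :
    ∏ i ∈ Finset.range L, ph (L * h) (w - i * h) = ph h w := by
  have hLh : 0 < (L : ℝ) * h := by positivity
  have t1 : Tendsto (fun N => ∏ i ∈ Finset.range L, (PN (-1) N (L * h) (w - i * h) / PN 1 N (L * h) (w - i * h)))
      atTop (𝓝 (∏ i ∈ Finset.range L, ph (L * h) (w - i * h))) :=
    tendsto_finsetProd _ fun i _ => ph_tendsto hLh _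
  have t2 : Tendsto (fun N => PN (-1) (L * N) h w / PN 1 (L * N) h w) atTop (𝓝 (ph h w)) :=
    (ph_tendsto hh w).comp (tendsto_id.const_mul_atTop' hL)
  refine tendsto_nhds_unique t1 (t2.congr fun N => ?_)
  rw [Finset.prod_div_distrib, PN_block, PN_block]

/-- symmetric product formula -/
theorem ph_sym {ℓ : ℕ} (hl : 0 < ℓ) {h : ℝ} (hh : 0 < h) (u : ℝ) :
    ∏ j ∈ Finset.range ℓ, (xf (2 * ℓ * h) u - xf (2 * ℓ * h) ((j + 1 / 2) * h)) /
      (xf (2 * ℓ * h) u + xf (2 * ℓ * h) ((j + 1 / 2) * h)) = ph h (u + (ℓ - 1 / 2) * h) := by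
  have hT : 0 < 2 * (ℓ : ℝ) * h := by positivity
  rw [← ph_block (L := ℓ + ℓ) (by omega) hh, Finset.prod_range_add,
    
    ← Finset.prod_range_reflect (fun i : ℕ => ph (((ℓ + ℓ : ℕ) : ℝ) * h) (u + (ℓ - 1 / 2) * h - i * h)) ℓ,
    ← Finset.prod_mul_distrib]
  refine Finset.prod_congr rfl fun j hj => ?_
  have hj' := Finset.mem_range.1 hj
  have hc : ((ℓ - 1 - j : ℕ) : ℝ) = ℓ - 1 - j := by
    rw [Nat.cast_sub (by omega), Nat.cast_sub (by omega)]; simp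
  rw [← ph_mul hT, hc]
  congr 2 <;> (push_cast; ring)

theorem ph_bound {T : ℝ} (hT : 0 < T) (w : ℝ) : |ph T w| ≤ 2 * exp (-(π ^ 2 / (2 * T))) := by
  have h2 : 0 < 2 * T := by positivity
  have key : ∀ u, ph T (u + T / 2) = (xf (2 * T) u - 1) / (xf (2 * T) u + 1) := by
    intro u
    have h := ph_sym (ℓ := 1) one_pos hT u
    have hq := xf_quarter h2
    simp only [Finset.prod_range_one, Nat.cast_one, Nat.cast_zero] at h
    rw [show 2 * 1 * T = 2 * T by ring, show (0 + 1 / 2) * T = 2 * T / 4 by ring, hq] at h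
    rw [h]; congr 1; ring
  set x0 := xf (2 * T) 0 with hx0
  have p0 : 0 < x0 := xf_pos h2 0
  have hx1 : x0 ≤ 1 := by
    have := xf_zero_min h2 (2 * T / 4)
    rwa [xf_quarter h2] at this
  have hM : |ph T w| ≤ (1 - x0) / (1 + x0) := by
    rw [show w = (w - T / 2) + T / 2 by ring, key]
    set x := xf (2 * T) (w - T / 2)
    have a1 : x0 ≤ x := xf_zero_min h2 _
    have a2 : x ≤ x0⁻¹ := xf_max h2 _
    have a3 : x * x0 ≤ 1 := by
      calc x * x0 ≤ x0⁻¹ * x0 := by gcongr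
        _ = 1 := inv_mul_cancel₀ p0.ne'
    have px : 0 < x := by linarith
    rw [abs_div, abs_of_pos (by linarith : 0 < x + 1), div_le_div_iff₀ (by linarith) (by linarith)]
    rcases abs_cases (x - 1) with ⟨h, _⟩ | ⟨h, _⟩ <;> rw [h] <;> nlinarith
  have hmid : ph T (-(T / 2)) = (1 - x0) / (1 + x0) := by
    have h := key (-T)
    rw [show -T + T / 2 = -(T / 2) by ring, xf_even] at h
    have hs := xf_shift h2 0
    rw [show 0 + 2 * T / 2 = T by ring] at hs
    have : xf (2 * T) T = 1 / x0 := by rw [eq_div_iff p0.ne']; exact hs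
    rw [h, this]; field_simp
  rw [← hmid, Th_poisson hT] at hM
  refine hM.trans ((xf_zero_le (by positivity)).trans (le_of_eq ?_))
  congr 2
  field_simp; ring

/-- Zolotarev bound on `[a,b]`. -/
theorem zolo {a b : ℝ} (ha : 0 < a) (hab : a < b) {ℓ : ℕ} (hl : 0 < ℓ) :
    ∃ p : ℕ → ℝ, (∀ j, 0 < p j) ∧ ∀ x ∈ Set.Icc a b,
      |∏ j ∈ Finset.range ℓ, (x - p j) / (x + p j)| ≤
        2 * exp (-(ℓ * (π ^ 2 / (2 * log (4 * b / a))))) := by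
  have hb : 0 < b := ha.trans hab
  have hlog : 0 < log (4 * b / a) := log_pos (by rw [lt_div_iff₀ ha]; linarith)
  set Λ := log (4 * b / a) with hΛ
  have hl' : (0 : ℝ) < ℓ := by exact_mod_cast hl
  set h := Λ / ℓ with hh
  have hhp : 0 < h := by positivity
  have hTe : 2 * (ℓ : ℝ) * h = 2 * Λ := by rw [hh]; field_simp
  have hT : 0 < 2 * Λ := by positivity
  set c := sqrt (a * b) with hc
  have hcp : 0 < c := sqrt_pos.2 (by positivity)
  have hc2 : c * c = a * b := mul_self_sqrt (by positivity)
  set x0 := xf (2 * Λ) 0 with hx0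
  have p0 : 0 < x0 := xf_pos hT 0
  have hx0a : c * x0 ≤ a := by
    have h1 := xf_zero_le hT
    have h2 : (2 * exp (-(2 * Λ) / 4)) ^ 2 = a / b := by
      rw [mul_pow, ← exp_nat_mul, show ((2 : ℕ) : ℝ) * (-(2 * Λ) / 4) = -Λ by push_cast; ring,
        exp_neg, hΛ, exp_log (by positivity)]
      field_simp; norm_num
    have h3 : x0 ^ 2 ≤ a / b := by rw [← h2]; gcongr
    have h4 : (c * x0) ^ 2 ≤ a ^ 2 := by
      calc (c * x0) ^ 2 = (a * b) * x0 ^ 2 := by rw [← hc2]; ring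
        _ ≤ (a * b) * (a / b) := by gcongr
        _ = a ^ 2 := by field_simp
    exact le_of_sq_le_sq h4 ha.le
  have hend : xf (2 * Λ) Λ = x0⁻¹ := by
    have hs := xf_shift hT 0
    rw [show 0 + 2 * Λ / 2 = Λ by ring] at hs
    exact eq_inv_of_mul_eq_one_left hs
  have hx0b : b ≤ c * x0⁻¹ := by
    rw [← div_eq_mul_inv, le_div_iff₀ p0]
    have : c * (b * x0) ≤ c * c := by rw [hc2]; nlinarith
    exact le_of_mul_le_mul_left this hcp
  refine ⟨fun j => c * xf (2 * Λ) ((j + 1 / 2) * h), fun j => mul_pos hcp (xf_pos hT _), ?_⟩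
  intro x hx
  obtain ⟨u, -, hu⟩ : x / c ∈ xf (2 * Λ) '' Set.Icc 0 Λ := by
    apply intermediate_value_Icc hlog.le (xf_cont hT).continuousOn
    rw [hend]
    constructor
    · rw [le_div_iff₀ hcp]; linarith [hx.1]
    · rw [div_le_iff₀ hcp]; linarith [hx.2]
  have hxu : x = c * xf (2 * Λ) u := by rw [hu]; field_simp
  have hs := ph_sym hl hhp u
  rw [hTe] at hs
  have : ∏ j ∈ Finset.range ℓ, (x - c * xf (2 * Λ) ((j + 1 / 2) * h)) /
      (x + c * xf (2 * Λ) ((j + 1 / 2) * h)) = ph h (u + (ℓ - 1 / 2) * h) := by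
    rw [← hs]
    refine Finset.prod_congr rfl fun j _ => ?_
    rw [hxu, ← mul_sub, ← mul_add, mul_div_mul_left _ _ hcp.ne']
  rw [this]
  refine (ph_bound hhp _).trans (le_of_eq ?_)
  congr 3
  rw [hh]; field_simp
end SylvAux

namespace SylvAux
section Mat
open scoped Matrix.Norms.L2Operator

theorem specNorm_eq {n : ℕ} (M : Matrix (Fin n) (Fin n) ℝ) : specNorm M = ‖M‖ := rfl

/-- An evaluation functional calculus for a Hermitian matrix. -/
theorem exists_fc {n : ℕ} (A : Matrix (Fin n) (Fin n) ℝ) (hA : A.IsHermitian) (s : Set ℝ)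
    (hs : spectrum ℝ A ⊆ s) :
    ∃ Φ : (ℝ → ℝ) →ₐ[ℝ] Matrix (Fin n) (Fin n) ℝ, Φ id = A ∧
      (∀ f g : ℝ → ℝ, (∀ x ∈ s, f x = g x) → Φ f = Φ g) ∧
      (∀ (f : ℝ → ℝ) (c : ℝ), 0 ≤ c → (∀ x ∈ s, |f x| ≤ c) → ‖Φ f‖ ≤ c) := by
  have hev : ∀ i, hA.eigenvalues i ∈ s := fun i => hs (hA.eigenvalues_mem_spectrum_real i)
  let e : (ℝ → ℝ) →ₐ[ℝ] (Fin n → ℝ) :=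
    AlgHom.pi (fun i => Pi.evalAlgHom ℝ (fun _ : ℝ => ℝ) (hA.eigenvalues i))
  let U := Unitary.conjStarAlgAut ℝ _ hA.eigenvectorUnitary
  refine ⟨((U : _ ≃⋆ₐ[ℝ] _).toAlgEquiv : _ →ₐ[ℝ] _).comp
      ((Matrix.diagonalAlgHom ℝ).comp e), ?_, ?_, ?_⟩
  · conv_rhs => rw [hA.spectral_theorem]
    rfl
  · intro f g h
    have : e f = e g := by
      funext i
      exact h _ (hev i)
    simp [this]
  · intro f c hc h
    change ‖U (diagonal (e f))‖ ≤ c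
    rw [Unitary.conjStarAlgAut_apply, ← Unitary.coe_star, CStarRing.norm_mul_coe_unitary,
      CStarRing.norm_coe_unitary_mul, l2_opNorm_diagonal, pi_norm_le_iff_of_nonneg hc]
    intro i
    exact h _ (hev i)

theorem rank_add_le' {n : ℕ} (M N : Matrix (Fin n) (Fin n) ℝ) :
    (M + N).rank ≤ M.rank + N.rank := by
  unfold Matrix.rank
  rw [Matrix.mulVecLin_add]
  refine (Submodule.finrank_mono (LinearMap.range_add_le _ _)).trans ?_
  exact Submodule.finrank_add_le_finrank_add_finrank _ _

theorem adi {n k : ℕ} (A B C X : Matrix (Fin n) (Fin n) ℝ) (s : Set ℝ) (hpos : ∀ x ∈ s, 0 < x)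
    (Φ Ψ : (ℝ → ℝ) →ₐ[ℝ] Matrix (Fin n) (Fin n) ℝ)
    (hΦ : Φ id = A) (hΨ : Ψ id = B)
    (hΦ2 : ∀ f g : ℝ → ℝ, (∀ x ∈ s, f x = g x) → Φ f = Φ g)
    (hΨ2 : ∀ f g : ℝ → ℝ, (∀ x ∈ s, f x = g x) → Ψ f = Ψ g)
    (hX : A * X + X * B = C) (hC : C.rank ≤ k) (p : ℕ → ℝ) (hp : ∀ j, 0 < p j) (ℓ : ℕ) :
    ∃ M : Matrix (Fin n) (Fin n) ℝ, M.rank ≤ k * ℓ ∧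
      X - M = Φ (fun x => ∏ j ∈ Finset.range ℓ, (x - p j) / (x + p j)) * X *
        Ψ (fun x => ∏ j ∈ Finset.range ℓ, (x - p j) / (x + p j)) := by
  induction ℓ with
  | zero =>
    refine ⟨0, by simp, ?_⟩
    have : (fun x : ℝ => ∏ j ∈ Finset.range 0, (x - p j) / (x + p j)) = 1 := by
      funext x; simp
    rw [this, map_one, map_one]; simp
  | succ ℓ ih =>
    obtain ⟨M, hM, hY⟩ := ih
    set f : ℝ → ℝ := fun x => ∏ j ∈ Finset.range ℓ, (x - p j) / (x + p j) with hf
    set v : ℝ → ℝ := fun x => 1 / (x + p ℓ) with hv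
    set w : ℝ → ℝ := fun x => (x - p ℓ) / (x + p ℓ) with hw
    have hsucc : (fun x : ℝ => ∏ j ∈ Finset.range (ℓ+1), (x - p j) / (x + p j)) = w * f := by
      funext x; rw [Finset.prod_range_succ, mul_comm]; rfl
    have hsucc' : (fun x : ℝ => ∏ j ∈ Finset.range (ℓ+1), (x - p j) / (x + p j)) = f * w := by
      funext x; rw [Finset.prod_range_succ]; rfl
    have h1 : ∀ x ∈ s, w x = (v * (id - algebraMap ℝ (ℝ → ℝ) (p ℓ)) : ℝ → ℝ) x := by
      intro x hx
      simp [hw, hv]; ring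
    have h2 : ∀ x ∈ s, (1 : ℝ → ℝ) x = (v * (id + algebraMap ℝ (ℝ → ℝ) (p ℓ)) : ℝ → ℝ) x := by
      intro x hx
      have : x + p ℓ ≠ 0 := by have := hpos x hx; have := hp ℓ; positivity
      simp [hv]; field_simp
    have a1 := hΦ2 _ _ h1
    have a2 := hΦ2 _ _ h2
    have b1 := hΨ2 _ _ h1
    have b2 := hΨ2 _ _ h2
    rw [mul_comm v] at b1 b2
    simp only [map_mul, map_sub, map_add, map_one, hΦ, AlgHom.commutes] at a1 a2
    simp only [map_mul, map_sub, map_add, map_one, hΨ, AlgHom.commutes] at b1 b2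
    have hcA : A * Φ f = Φ f * A := by rw [← hΦ, ← map_mul, ← map_mul, mul_comm]
    have hcB : B * Ψ f = Ψ f * B := by rw [← hΨ, ← map_mul, ← map_mul, mul_comm]
    have hYs : A * (X - M) + (X - M) * B = Φ f * C * Ψ f := by
      rw [hY, ← hX]
      calc _ = (A * Φ f) * X * Ψ f + Φ f * X * (Ψ f * B) := by noncomm_ring
        _ = _ := by rw [hcA, ← hcB]; noncomm_ring
    set P := algebraMap ℝ (Matrix (Fin n) (Fin n) ℝ) (p ℓ) with hP
    have hPc : ∀ Z, P * Z = Z * P := fun Z => Algebra.commutes _ _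
    set Y := X - M with hYd
    refine ⟨M + (2:ℝ) • (Φ v * (P * (Φ f * C * Ψ f)) * Ψ v), ?_, ?_⟩
    · refine (rank_add_le' _ _).trans ?_
      rw [mul_add, mul_one]
      refine add_le_add hM ?_
      have : (2:ℝ) • (Φ v * (P * (Φ f * C * Ψ f)) * Ψ v) =
          ((2:ℝ) • (Φ v * P * Φ f)) * C * (Ψ f * Ψ v) := by
        simp only [smul_mul_assoc, mul_assoc]
      rw [this]
      exact ((Matrix.rank_mul_le_left _ _).trans (Matrix.rank_mul_le_right _ _)).trans hC
    · nth_rewrite 1 [hsucc]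
      rw [hsucc', map_mul, map_mul]
      have e1 : Φ w * Φ f * X * (Ψ f * Ψ w) = Φ w * Y * Ψ w := by rw [hY]; simp only [mul_assoc]
      rw [e1, ← sub_sub, ← hYd, ← hYs, a1, b1]
      have e2 : Y = Φ v * (A + P) * Y * ((B + P) * Ψ v) := by
        rw [← a2, ← b2, one_mul, mul_one]
      have e3 : (A + P) * Y * (B + P) - (A - P) * Y * (B - P) = (2:ℝ) • (P * (A * Y + Y * B)) := by
        have h1 : P * (A * Y) = A * (Y * P) := by rw [hPc, mul_assoc]
        have h3 : P * (Y * B) = Y * (B * P) := by rw [hPc, mul_assoc]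
        have h4 : A * (P * Y) = A * (Y * P) := by rw [hPc]
        have h5 : P * (Y * P) = Y * (P * P) := by rw [hPc, mul_assoc]
        have h6 : Y * (P * B) = Y * (B * P) := by rw [hPc]
        rw [two_smul]
        simp only [add_mul, mul_add, sub_mul, mul_sub, mul_assoc, h1, h3, h4, h5, h6]
        abel
      calc _ = Φ v * (A + P) * Y * ((B + P) * Ψ v) -
              (2:ℝ) • (Φ v * (P * (A * Y + Y * B)) * Ψ v) := by rw [← e2]
        _ = Φ v * ((A + P) * Y * (B + P) - (2:ℝ) • (P * (A * Y + Y * B))) * Ψ v := by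
          simp only [mul_sub, sub_mul, mul_smul_comm, smul_mul_assoc, mul_assoc]
        _ = Φ v * ((A - P) * Y * (B - P)) * Ψ v := by rw [← e3]; simp
        _ = _ := by simp only [mul_assoc]

theorem main_of_zolo {n k : ℕ} (A B C X : Matrix (Fin n) (Fin n) ℝ)
    (hA : A.IsHermitian) (hB : B.IsHermitian) (s : Set ℝ) (hpos : ∀ x ∈ s, 0 < x)
    (hAs : spectrum ℝ A ⊆ s) (hBs : spectrum ℝ B ⊆ s)
    (hX : A * X + X * B = C) (hC : C.rank ≤ k) (p : ℕ → ℝ) (hp : ∀ j, 0 < p j) (ℓ : ℕ)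
    (c : ℝ) (hc : 0 ≤ c)
    (hr : ∀ x ∈ s, |∏ j ∈ Finset.range ℓ, (x - p j) / (x + p j)| ≤ c) :
    ∃ M : Matrix (Fin n) (Fin n) ℝ, M.rank ≤ k * ℓ ∧ specNorm (X - M) ≤ c * c * specNorm X := by
  obtain ⟨Φ, h1, h2, h3⟩ := exists_fc A hA s hAs
  obtain ⟨Ψ, g1, g2, g3⟩ := exists_fc B hB s hBs
  obtain ⟨M, hM, hE⟩ := adi A B C X s hpos Φ Ψ h1 g1 h2 g2 hX hC p hp ℓ
  refine ⟨M, hM, ?_⟩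
  rw [specNorm_eq, specNorm_eq, hE]
  have i1 := h3 _ c hc hr
  have i2 := g3 _ c hc hr
  calc _ ≤ ‖Φ _‖ * ‖X‖ * ‖Ψ _‖ := (l2_opNorm_mul _ _).trans
        (mul_le_mul_of_nonneg_right (l2_opNorm_mul _ _) (norm_nonneg _))
    _ ≤ c * ‖X‖ * c := by gcongr
    _ = _ := by ring
end Mat
end SylvAux

/-- **Low-rank approximability of solutions of SPD Sylvester equations.**
If `A`, `B` are symmetric positive definite with spectra in `[a,b]`, `0 < a < b`, and
`AX + XB = C` with `rank C ≤ k`, then with `ρ = exp(π² / (2 log(4b/a)))`, for every `ℓ ≥ 1`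
there is a matrix `M` of rank at most `k·ℓ` with `‖X - M‖₂ ≤ 4 ρ^(-2ℓ) ‖X‖₂`. -/
theorem sylvester_spd_low_rank_approx
    {n k : ℕ} (A B C X : Matrix (Fin n) (Fin n) ℝ)
    (hA : A.PosDef) (hB : B.PosDef)
    (a b : ℝ) (ha : 0 < a) (hab : a < b)
    (hAs : spectrum ℝ A ⊆ Set.Icc a b) (hBs : spectrum ℝ B ⊆ Set.Icc a b)
    (hX : A * X + X * B = C) (hC : C.rank ≤ k)
    (ρ : ℝ) (hρ : ρ = Real.exp (Real.pi ^ 2 / (2 * Real.log (4 * b / a)))) :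
    ∀ ℓ : ℕ, 1 ≤ ℓ →
      ∃ M : Matrix (Fin n) (Fin n) ℝ, M.rank ≤ k * ℓ ∧
        specNorm (X - M) ≤ 4 * ρ ^ (-(2 * (ℓ : ℤ))) * specNorm X := by
  intro ℓ hl
  obtain ⟨p, hp, hr⟩ := SylvAux.zolo ha hab (ℓ := ℓ) (by omega)
  obtain ⟨M, hM, hn⟩ := SylvAux.main_of_zolo A B C X hA.isHermitian hB.isHermitian (Set.Icc a b)
    (fun x hx => ha.trans_le hx.1) hAs hBs hX hC p hp ℓ _ (by positivity) hr
  refine ⟨M, hM, hn.trans (le_of_eq ?_)⟩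
  congr 1
  rw [hρ, ← Real.rpow_intCast, ← Real.exp_mul, mul_mul_mul_comm, ← Real.exp_add]
  push_cast
  ring_nf
end

section
/- Let A be a real symmetric positive definite n×n matrix with condition number κ_A = λ_max(A)/λ_min(A), and let X satisfy the Lyapunov equation AX + XA = C where C has rank at most k. Set ρ = exp(π² / (2·log(4·κ_A))). Then for every ℓ ≥ 1 there exists a matrix M of rank at most k·ℓ such that ‖X − M‖₂ ≤ 4·ρ^(−2ℓ)·‖X‖₂. -/
section ThetaPart
open Filter Topology

noncomputable def thT (P : ℝ) (z : ℂ) : ℂ := ∑' m : ℤ, (P : ℂ) ^ (m ^ 2) * z ^ m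

lemma thT_term_eq {P : ℝ} (hP : 0 < P) (ζ : ℂ) (m : ℤ) :
    (P : ℂ) ^ (m ^ 2) * (Complex.exp (2 * Real.pi * Complex.I * ζ)) ^ m =
      jacobiTheta₂_term m ζ (Complex.I * ((-Real.log P / Real.pi : ℝ) : ℂ)) := by
  have h1 : (P : ℂ) = Complex.exp ((Real.log P : ℝ) : ℂ) := by
    rw [← Complex.ofReal_exp, Real.exp_log hP]
  have hpi : (Real.pi : ℂ) ≠ 0 := by exact_mod_cast Real.pi_ne_zero
  rw [h1, ← Complex.exp_int_mul, ← Complex.exp_int_mul, ← Complex.exp_add, jacobiTheta₂_term]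
  congr 1
  push_cast
  field_simp
  ring_nf
  simp only [Complex.I_sq]
  ring

lemma thT_tau_im {P : ℝ} (hP : 0 < P) (hP1 : P < 1) :
    0 < (Complex.I * ((-Real.log P / Real.pi : ℝ) : ℂ)).im := by
  have : Real.log P < 0 := Real.log_neg hP hP1
  rw [Complex.I_mul_im, Complex.ofReal_re]
  exact div_pos (by linarith) Real.pi_pos

lemma exists_exp_two_pi {z : ℂ} (hz : z ≠ 0) :
    ∃ ζ : ℂ, z = Complex.exp (2 * Real.pi * Complex.I * ζ) := by
  refine ⟨Complex.log z / (2 * Real.pi * Complex.I), ?_⟩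
  rw [mul_div_cancel₀ _ Complex.two_pi_I_ne_zero, Complex.exp_log hz]

lemma thT_summable {P : ℝ} (hP : 0 < P) (hP1 : P < 1) {z : ℂ} (hz : z ≠ 0) :
    Summable (fun m : ℤ => (P : ℂ) ^ (m ^ 2) * z ^ m) := by
  obtain ⟨ζ, rfl⟩ := exists_exp_two_pi hz
  simp_rw [thT_term_eq hP]
  exact (summable_jacobiTheta₂_term_iff _ _).2 (thT_tau_im hP hP1)

lemma thT_eq_jacobi {P : ℝ} (hP : 0 < P) (ζ : ℂ) :
    thT P (Complex.exp (2 * Real.pi * Complex.I * ζ)) =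
      jacobiTheta₂ ζ (Complex.I * ((-Real.log P / Real.pi : ℝ) : ℂ)) := by
  unfold thT jacobiTheta₂
  simp_rw [thT_term_eq hP]

/-- reciprocal q-factorials extended by zero -/
noncomputable def qa (Q : ℝ) (j : ℤ) : ℝ :=
  if j < 0 then 0 else ∏ i ∈ Finset.range j.toNat, (1 - Q ^ (i + 1))⁻¹

lemma qa_step {Q : ℝ} (hQ : 0 < Q) (hQ1 : Q < 1) (j : ℤ) :
    qa Q (j - 1) = (1 - Q ^ j) * qa Q j := by
  unfold qa
  rcases lt_trichotomy j 0 with h | h | h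
  · rw [if_pos (by omega), if_pos h, mul_zero]
  · subst h; simp
  · obtain ⟨n, rfl⟩ : ∃ n : ℕ, j = n + 1 := ⟨(j - 1).toNat, by omega⟩
    have h1 : ((n : ℤ) + 1 - 1).toNat = n := by omega
    have h2 : ((n : ℤ) + 1).toNat = n + 1 := by omega
    rw [if_neg (by omega), if_neg (by omega), h1, h2, Finset.prod_range_succ]
    have h3 : Q ^ ((n : ℤ) + 1) = Q ^ (n + 1) := by exact_mod_cast zpow_natCast Q (n + 1)
    rw [h3]
    have : (1 - Q ^ (n + 1)) ≠ 0 := by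
      have := pow_lt_one₀ hQ.le hQ1 (Nat.succ_ne_zero n)
      rw [Nat.succ_eq_add_one] at this
      linarith
    field_simp

noncomputable def qf (Q : ℝ) (n : ℕ) : ℝ := ∏ i ∈ Finset.range n, (1 - Q ^ (i + 1))

noncomputable def thProd (P : ℝ) (N : ℕ) (z : ℂ) : ℂ :=
  ∏ n ∈ Finset.range N, ((1 + (P : ℂ) ^ (2 * n + 1) * z) * (1 + (P : ℂ) ^ (2 * n + 1) * z⁻¹))

noncomputable def qc (P : ℝ) (N : ℕ) (m : ℤ) : ℝ :=
  qf (P ^ 2) (2 * N) * (qa (P ^ 2) (N + m) * qa (P ^ 2) (N - m))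

lemma qc_rec_aux (s t Q : ℝ) (ht : t ≠ 0) : (1 - s^2*Q)*(1-s^2*Q^2) = (1+s^2*Q)*(1-s*Q*t)*(1-s*Q/t)+ (s*Q/t)*((1-s*t)*(1-s*Q*t))+ s*Q*t*((1-s/t)*(1-s*Q/t)) := by
  field_simp
  ring

lemma qc_rec {P : ℝ} (hP : 0 < P) (hP1 : P < 1) (N : ℕ) (m : ℤ) :
    qc P (N + 1) m * P ^ (m ^ 2) = (1 + P ^ (4 * N + 2)) * (qc P N m * P ^ (m ^ 2))
      + P ^ (2 * N + 1) * (qc P N (m - 1) * P ^ ((m - 1) ^ 2))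
      + P ^ (2 * N + 1) * (qc P N (m + 1) * P ^ ((m + 1) ^ 2)) := by
  have hQ : 0 < P ^ 2 := by positivity
  have hQ1 : P ^ 2 < 1 := by nlinarith
  have hP0 : P ≠ 0 := hP.ne'
  set u := qa (P ^ 2) (N + 1 + m) with hu
  set v := qa (P ^ 2) (N + 1 - m) with hv
  have e1 : qa (P ^ 2) (N + m) = (1 - (P ^ 2) ^ ((N : ℤ) + 1 + m)) * u := by
    rw [hu, ← qa_step hQ hQ1]; congr 1; ring
  have e2 : qa (P ^ 2) (N + (m - 1)) = (1 - (P ^ 2) ^ ((N : ℤ) + m)) * ((1 - (P ^ 2) ^ ((N : ℤ) + 1 + m)) * u) := by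
    rw [← e1, ← qa_step hQ hQ1]; congr 1; ring
  have e3 : qa (P ^ 2) (N - m) = (1 - (P ^ 2) ^ ((N : ℤ) + 1 - m)) * v := by
    rw [hv, ← qa_step hQ hQ1]; congr 1; ring
  have e4 : qa (P ^ 2) (N - (m + 1)) = (1 - (P ^ 2) ^ ((N : ℤ) - m)) * ((1 - (P ^ 2) ^ ((N : ℤ) + 1 - m)) * v) := by
    rw [← e3, ← qa_step hQ hQ1]; congr 1; ring
  have e5 : qa (P ^ 2) (N - (m - 1)) = v := by rw [hv]; congr 1; ring
  have e6 : qa (P ^ 2) (N + (m + 1)) = u := by rw [hu]; congr 1; ring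
  have e7 : qf (P ^ 2) (2 * (N + 1)) = qf (P ^ 2) (2 * N) * (1 - (P ^ 2) ^ (2 * N + 1)) * (1 - (P ^ 2) ^ (2 * N + 2)) := by
    unfold qf
    rw [show 2 * (N + 1) = 2 * N + 1 + 1 by ring, Finset.prod_range_succ, Finset.prod_range_succ]
  have key := qc_rec_aux ((P ^ 2) ^ N) ((P ^ 2) ^ m) (P ^ 2) (zpow_ne_zero _ hQ.ne')
  have f1 : P ^ ((m - 1) ^ 2) = P ^ (m ^ 2) * (P / (P ^ 2) ^ m) := by
    rw [← zpow_natCast P 2, ← zpow_mul, show (m - 1) ^ 2 = m ^ 2 + (1 - (2 : ℕ) * m) by push_cast; ring, zpow_add₀ hP0, zpow_sub₀ hP0, zpow_one]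
  have f2 : P ^ ((m + 1) ^ 2) = P ^ (m ^ 2) * (P * (P ^ 2) ^ m) := by
    rw [← zpow_natCast P 2, ← zpow_mul, show (m + 1) ^ 2 = m ^ 2 + (1 + (2 : ℕ) * m) by push_cast; ring, zpow_add₀ hP0, zpow_add₀ hP0, zpow_one]
  unfold qc
  push_cast
  rw [e1, e2, e3, e4, e5, e6, e7, f1, f2]
  simp only [zpow_add₀ hQ.ne', zpow_sub₀ hQ.ne', zpow_natCast, zpow_one]
  have g1 : (P ^ 2) ^ (2 * N + 1) = ((P ^ 2) ^ N) ^ 2 * P ^ 2 := by ring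
  have g2 : (P ^ 2) ^ (2 * N + 2) = ((P ^ 2) ^ N) ^ 2 * (P ^ 2) ^ 2 := by ring
  have g3 : P ^ (4 * N + 2) = ((P ^ 2) ^ N) ^ 2 * P ^ 2 := by rw [← pow_mul, ← pow_mul, ← pow_add]; congr 1; ring
  have g4 : P ^ (2 * N + 1) = (P ^ 2) ^ N * P := by rw [← pow_mul, ← pow_succ]
  rw [g1, g2, g3, g4]
  linear_combination (qf (P ^ 2) (2 * N) * u * v * P ^ (m ^ 2)) * key

lemma thProd_hasSum {P : ℝ} (hP : 0 < P) (hP1 : P < 1) {z : ℂ} (hz : z ≠ 0) (N : ℕ) :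
    HasSum (fun m : ℤ => ((qc P N m * P ^ (m ^ 2) : ℝ) : ℂ) * z ^ m) (thProd P N z) := by
  induction N with
  | zero =>
    have := hasSum_single (f := fun m : ℤ => ((qc P 0 m * P ^ (m ^ 2) : ℝ) : ℂ) * z ^ m) 0 (by
      intro m hm
      have : qc P 0 m = 0 := by
        unfold qc qa
        rcases lt_or_gt_of_ne hm with h | h
        · rw [if_pos (by simpa using h)]; simp
        · rw [if_pos (show ((0:ℕ):ℤ) - m < 0 by simpa using h)]; simp
      simp [this])
    convert this using 1
    simp [thProd, qc, qf, qa]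
  | succ N ih =>
    have h1 := ih.mul_left (1 + (P : ℂ) ^ (4 * N + 2))
    have h2 := ((Equiv.subRight (1 : ℤ)).hasSum_iff.2 ih).mul_left ((P : ℂ) ^ (2 * N + 1) * z)
    have h3 := ((Equiv.addRight (1 : ℤ)).hasSum_iff.2 ih).mul_left ((P : ℂ) ^ (2 * N + 1) * z⁻¹)
    have e : thProd P (N + 1) z = (1 + (P : ℂ) ^ (4 * N + 2)) * thProd P N z
        + (P : ℂ) ^ (2 * N + 1) * z * thProd P N z
        + (P : ℂ) ^ (2 * N + 1) * z⁻¹ * thProd P N z := by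
      have : thProd P (N + 1) z = thProd P N z *
          ((1 + (P : ℂ) ^ (2 * N + 1) * z) * (1 + (P : ℂ) ^ (2 * N + 1) * z⁻¹)) := by
        unfold thProd
        rw [Finset.prod_range_succ]
      rw [this]
      field_simp
      ring
    rw [e]
    have h4 := (h1.add h2).add h3
    refine Eq.mp (congrArg (fun f => HasSum f _) (funext fun m => Eq.symm ?_)) h4
    rw [qc_rec hP hP1]
    simp only [Function.comp, Equiv.subRight_apply, Equiv.coe_addRight]
    rw [zpow_sub₀ hz, zpow_add₀ hz, zpow_one]
    push_cast
    field_simp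

lemma qf_lim {Q : ℝ} (hQ : 0 < Q) (hQ1 : Q < 1) :
    ∃ c : ℝ, 0 < c ∧ Tendsto (qf Q) atTop (𝓝 c) ∧ ∀ n, c ≤ qf Q n := by
  have hs : Summable (fun i : ℕ => ‖-Q ^ (i + 1)‖) := by
    have := (summable_nat_add_iff 1).2 (summable_geometric_of_lt_one hQ.le hQ1)
    simpa [abs_of_pos hQ] using this
  have hm := multipliable_one_add_of_summable hs
  have ht := hm.hasProd.tendsto_prod_nat
  have hne := tprod_one_add_ne_zero_of_summable (f := fun i : ℕ => -Q ^ (i + 1)) (by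
    intro i
    have := pow_lt_one₀ hQ.le hQ1 (Nat.succ_ne_zero i)
    rw [Nat.succ_eq_add_one] at this
    have : 0 < 1 + -Q ^ (i + 1) := by linarith
    exact this.ne') hs
  have hpos : ∀ i : ℕ, 0 < 1 - Q ^ (i + 1) := fun i => by
    have := pow_lt_one₀ hQ.le hQ1 (Nat.succ_ne_zero i)
    rw [Nat.succ_eq_add_one] at this
    linarith
  have ht' : Tendsto (qf Q) atTop (𝓝 (∏' i : ℕ, (1 + -Q ^ (i + 1)))) := by
    refine ht.congr (fun n => ?_)
    simp [qf, sub_eq_add_neg]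
  have hq0 : ∀ n, 0 ≤ qf Q n := fun n => Finset.prod_nonneg fun i _ => (hpos i).le
  have hanti : Antitone (qf Q) := by
    refine antitone_nat_of_succ_le fun n => ?_
    unfold qf
    rw [Finset.prod_range_succ]
    have : 0 < Q ^ (n + 1) := by positivity
    exact mul_le_of_le_one_right (hq0 n) (by linarith)
  exact ⟨_, lt_of_le_of_ne (ge_of_tendsto' ht' hq0) (Ne.symm hne), ht', fun n => hanti.le_of_tendsto ht' n⟩

lemma qa_eq (Q : ℝ) (n : ℕ) : qa Q n = (qf Q n)⁻¹ := by
  simp [qa, qf]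

lemma thProd_tendsto {P : ℝ} (hP : 0 < P) (hP1 : P < 1) :
    ∃ A : ℝ, 0 < A ∧ ∀ z : ℂ, z ≠ 0 →
      Tendsto (fun N => thProd P N z) atTop (𝓝 (A * thT P z)) := by
  have hQ : 0 < P ^ 2 := by positivity
  have hQ1 : P ^ 2 < 1 := by nlinarith
  obtain ⟨c, hc, hlim, hle⟩ := qf_lim hQ hQ1
  have hpos : ∀ n, 0 < qf (P ^ 2) n := fun n => hc.trans_le (hle n)
  have hqf1 : ∀ n, qf (P ^ 2) n ≤ 1 := fun n => by
    unfold qf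
    refine Finset.prod_le_one (fun i _ => ?_) (fun i _ => ?_)
    · have := pow_le_one₀ (n := i + 1) hQ.le hQ1.le
      linarith
    · have : 0 < (P ^ 2) ^ (i + 1) := by positivity
      linarith
  have hqa0 : ∀ j, 0 ≤ qa (P ^ 2) j := fun j => by
    rcases lt_or_ge j 0 with h | h
    · simp [qa, h]
    · lift j to ℕ using h
      rw [qa_eq]; exact (inv_pos.2 (hpos _)).le
  have hqa1 : ∀ j, qa (P ^ 2) j ≤ c⁻¹ := fun j => by
    rcases lt_or_ge j 0 with h | h
    · simp [qa, h, hc.le]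
    · lift j to ℕ using h
      rw [qa_eq]; exact inv_anti₀ hc (hle _)
  have hqat : Tendsto (qa (P ^ 2)) atTop (𝓝 c⁻¹) := by
    have h1 : Tendsto (fun j : ℤ => (qf (P ^ 2) j.toNat)⁻¹) atTop (𝓝 c⁻¹) :=
      (hlim.inv₀ hc.ne').comp (tendsto_atTop_atTop.2 fun b => ⟨b, fun a ha => by omega⟩)
    refine h1.congr' ?_
    filter_upwards [eventually_ge_atTop 0] with j hj
    lift j to ℕ using hj
    rw [qa_eq]; simp
  refine ⟨c⁻¹, inv_pos.2 hc, fun z hz => ?_⟩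
  have hcast : Tendsto (fun N : ℕ => (N : ℤ)) atTop atTop := tendsto_natCast_atTop_atTop
  have hqc : ∀ m : ℤ, Tendsto (fun N : ℕ => qc P N m) atTop (𝓝 c⁻¹) := fun m => by
    have h1 : Tendsto (fun N : ℕ => qf (P ^ 2) (2 * N)) atTop (𝓝 c) :=
      hlim.comp (tendsto_atTop_atTop.2 fun b => ⟨b, fun a ha => by omega⟩)
    have h2 : Tendsto (fun N : ℕ => qa (P ^ 2) (N + m)) atTop (𝓝 c⁻¹) :=
      hqat.comp (tendsto_atTop_add_const_right _ _ hcast)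
    have h3 : Tendsto (fun N : ℕ => qa (P ^ 2) (N - m)) atTop (𝓝 c⁻¹) := by
      simp_rw [sub_eq_add_neg]
      exact hqat.comp (tendsto_atTop_add_const_right _ _ hcast)
    have := h1.mul (h2.mul h3)
    rwa [mul_inv_cancel_left₀ hc.ne'] at this
  have hb : ∀ N m, |qc P N m| ≤ c⁻¹ * c⁻¹ := fun N m => by
    unfold qc
    rw [abs_of_nonneg (mul_nonneg (hpos _).le (mul_nonneg (hqa0 _) (hqa0 _)))]
    calc _ ≤ 1 * (c⁻¹ * c⁻¹) := by
          have := hqa1 (N + m)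
          have := hqa1 (N - m)
          have := hqa0 (N + m)
          have := hqa0 (N - m)
          have := hqf1 (2 * N)
          have := (hpos (2 * N)).le
          have := (inv_pos.2 hc).le
          gcongr
      _ = _ := one_mul _
  have := tendsto_tsum_of_dominated_convergence (𝓕 := atTop)
    (f := fun (N : ℕ) (m : ℤ) => ((qc P N m * P ^ (m ^ 2) : ℝ) : ℂ) * z ^ m)
    (g := fun m : ℤ => ((c⁻¹ : ℝ) : ℂ) * ((P : ℂ) ^ (m ^ 2) * z ^ m))
    (bound := fun m => c⁻¹ * c⁻¹ * ‖(P : ℂ) ^ (m ^ 2) * z ^ m‖)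
    ((thT_summable hP hP1 hz).norm.mul_left _)
    (fun m => by
      have := ((Complex.continuous_ofReal.tendsto _).comp (hqc m)).mul_const ((P : ℂ) ^ (m ^ 2) * z ^ m)
      refine this.congr fun N => ?_
      simp only [Function.comp]
      push_cast
      ring)
    (Eventually.of_forall fun N m => by
      have : ((qc P N m * P ^ (m ^ 2) : ℝ) : ℂ) * z ^ m = (qc P N m : ℂ) * ((P : ℂ) ^ (m ^ 2) * z ^ m) := by
        push_cast; ring
      rw [this, norm_mul, Complex.norm_real, Real.norm_eq_abs]
      gcongr
      exact hb N m)
  rw [tsum_mul_left] at this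
  refine this.congr fun N => ?_
  exact (thProd_hasSum hP hP1 hz N).tsum_eq

lemma unit_factor {w : ℂ} (hw : ‖w‖ = 1) (c : ℝ) :
    (1 + (c : ℂ) * w) * (1 + (c : ℂ) * w⁻¹) = ((‖1 + (c : ℂ) * w‖ ^ 2 : ℝ) : ℂ) := by
  have h : w⁻¹ = (starRingEnd ℂ) w := Complex.inv_eq_conj hw
  rw [h]
  have := Complex.mul_conj' (1 + (c : ℂ) * w)
  push_cast
  rw [← this]
  simp

lemma thProd_unit {P : ℝ} {w : ℂ} (hw : ‖w‖ = 1) (N : ℕ) :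
    thProd P N w = ((∏ n ∈ Finset.range N, ‖1 + ((P ^ (2 * n + 1) : ℝ) : ℂ) * w‖ ^ 2 : ℝ) : ℂ) := by
  unfold thProd
  rw [Complex.ofReal_prod]
  refine Finset.prod_congr rfl fun n _ => ?_
  rw [← unit_factor hw]
  push_cast
  rfl

lemma ne_zero_of_unit {w : ℂ} (hw : ‖w‖ = 1) : w ≠ 0 := by
  rintro rfl; simp at hw

lemma thProd_neg_one_le {P : ℝ} (hP : 0 < P) (hP1 : P < 1) {w : ℂ} (hw : ‖w‖ = 1) (N : ℕ) :
    (thProd P N (-1)).re ≤ (thProd P N w).re := by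
  rw [thProd_unit hw, thProd_unit (by simp), Complex.ofReal_re, Complex.ofReal_re]
  refine Finset.prod_le_prod (fun n _ => by positivity) fun n _ => ?_
  have h1 : P ^ (2 * n + 1) ≤ 1 := pow_le_one₀ hP.le hP1.le
  have h0 : 0 < P ^ (2 * n + 1) := by positivity
  set c := P ^ (2 * n + 1)
  have e1 : ‖1 + (c : ℂ) * -1‖ = 1 - c := by
    rw [show (1 + (c : ℂ) * -1) = ((1 - c : ℝ) : ℂ) by push_cast; ring, Complex.norm_real,
      Real.norm_eq_abs, abs_of_nonneg (by linarith)]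
  have e2 : 1 - c ≤ ‖1 + (c : ℂ) * w‖ := by
    have h := norm_sub_norm_le (1 : ℂ) (-((c : ℂ) * w))
    rw [norm_neg, norm_mul, hw, norm_one, mul_one, Complex.norm_real, Real.norm_eq_abs,
      abs_of_pos h0, sub_neg_eq_add] at h
    exact h
  rw [e1]
  exact pow_le_pow_left₀ (by linarith) e2 2

lemma thProd_neg_one_ge {P : ℝ} (hP : 0 < P) (hP1 : P < 1) (N : ℕ) :
    (qf P (2 * N)) ^ 2 ≤ (thProd P N (-1)).re := by
  rw [thProd_unit (by simp), Complex.ofReal_re]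
  induction N with
  | zero => simp [qf]
  | succ N ih =>
    rw [Finset.prod_range_succ]
    have e : qf P (2 * (N + 1)) = qf P (2 * N) * (1 - P ^ (2 * N + 1)) * (1 - P ^ (2 * N + 2)) := by
      unfold qf
      rw [show 2 * (N + 1) = 2 * N + 1 + 1 by ring, Finset.prod_range_succ, Finset.prod_range_succ]
    have h1 : P ^ (2 * N + 1) ≤ 1 := pow_le_one₀ hP.le hP1.le
    have h2 : P ^ (2 * N + 2) ≤ 1 := pow_le_one₀ hP.le hP1.le
    have h3 : 0 < P ^ (2 * N + 2) := by positivity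
    have e1 : ‖1 + ((P ^ (2 * N + 1) : ℝ) : ℂ) * -1‖ = 1 - P ^ (2 * N + 1) := by
      rw [show (1 + ((P ^ (2 * N + 1) : ℝ) : ℂ) * -1) = ((1 - P ^ (2 * N + 1) : ℝ) : ℂ) by
        push_cast; ring, Complex.norm_real,
        Real.norm_eq_abs, abs_of_nonneg (by linarith)]
    rw [e, e1, mul_pow, mul_pow]
    calc _ ≤ (qf P (2 * N)) ^ 2 * (1 - P ^ (2 * N + 1)) ^ 2 * 1 := by
          gcongr
          exact pow_le_one₀ (by linarith) (by linarith)
      _ ≤ _ := by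
          rw [mul_one]
          gcongr

lemma thT_real {P : ℝ} (hP : 0 < P) (hP1 : P < 1) {w : ℂ} (hw : ‖w‖ = 1) :
    thT P w = ((thT P w).re : ℂ) := by
  obtain ⟨A, hA, hlim⟩ := thProd_tendsto hP hP1
  have h := hlim w (ne_zero_of_unit hw)
  have h2 := (Complex.continuous_im.tendsto _).comp h
  have h3 : Tendsto (fun _ : ℕ => (0 : ℝ)) atTop (𝓝 ((A : ℂ) * thT P w).im) := by
    refine h2.congr fun N => ?_
    simp only [Function.comp]
    rw [thProd_unit hw, Complex.ofReal_im]
  have h4 := tendsto_nhds_unique h3 tendsto_const_nhds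
  rw [Complex.im_ofReal_mul] at h4
  have h5 : (thT P w).im = 0 := (mul_eq_zero.1 h4).resolve_left hA.ne'
  exact Complex.ext (by simp) (by simpa using h5)

lemma thT_neg_one_le {P : ℝ} (hP : 0 < P) (hP1 : P < 1) {w : ℂ} (hw : ‖w‖ = 1) :
    (thT P (-1)).re ≤ (thT P w).re := by
  obtain ⟨A, hA, hlim⟩ := thProd_tendsto hP hP1
  have h := (Complex.continuous_re.tendsto _).comp (hlim w (ne_zero_of_unit hw))
  have h' := (Complex.continuous_re.tendsto _).comp (hlim (-1) (by simp))
  have := le_of_tendsto_of_tendsto' h' h (fun N => thProd_neg_one_le hP hP1 hw N)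
  rw [Complex.re_ofReal_mul, Complex.re_ofReal_mul] at this
  exact le_of_mul_le_mul_left this hA

lemma thT_neg_one_pos {P : ℝ} (hP : 0 < P) (hP1 : P < 1) : 0 < (thT P (-1)).re := by
  obtain ⟨A, hA, hlim⟩ := thProd_tendsto hP hP1
  obtain ⟨c, hc, -, hle⟩ := qf_lim hP hP1
  have h' := (Complex.continuous_re.tendsto _).comp (hlim (-1) (by simp))
  have := ge_of_tendsto' h' (b := c ^ 2) (fun N =>
    (pow_le_pow_left₀ hc.le (hle (2 * N)) 2).trans (thProd_neg_one_ge hP hP1 N))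
  rw [Complex.re_ofReal_mul] at this
  exact (mul_pos_iff_of_pos_left hA).1 ((pow_pos hc 2).trans_le this)

lemma thT_pos {P : ℝ} (hP : 0 < P) (hP1 : P < 1) {w : ℂ} (hw : ‖w‖ = 1) :
    0 < (thT P w).re := (thT_neg_one_pos hP hP1).trans_le (thT_neg_one_le hP hP1 hw)

lemma thT_ne {P : ℝ} (hP : 0 < P) (hP1 : P < 1) {w : ℂ} (hw : ‖w‖ = 1) :
    thT P w ≠ 0 := fun h => by simpa [h] using thT_pos hP hP1 hw

lemma thT_norm {P : ℝ} (hP : 0 < P) (hP1 : P < 1) {w : ℂ} (hw : ‖w‖ = 1) :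
    ‖thT P w‖ = (thT P w).re := by
  conv_lhs => rw [thT_real hP hP1 hw]
  rw [Complex.norm_real, Real.norm_eq_abs, abs_of_pos (thT_pos hP hP1 hw)]

lemma thT_norm_term {P : ℝ} (hP : 0 < P) (z : ℂ) (m : ℤ) :
    ‖(P : ℂ) ^ (m ^ 2) * z ^ m‖ = P ^ (m ^ 2) * ‖z‖ ^ m := by
  rw [norm_mul, norm_zpow, norm_zpow, Complex.norm_real, Real.norm_eq_abs, abs_of_pos hP]

lemma thT_norm_le {P : ℝ} (hP : 0 < P) (hP1 : P < 1) {z : ℂ} (hz : z ≠ 0) :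
    ‖thT P z‖ ≤ ∑' m : ℤ, P ^ (m ^ 2) * ‖z‖ ^ m := by
  have := norm_tsum_le_tsum_norm (thT_summable hP hP1 hz).norm
  simp_rw [thT_norm_term hP] at this
  exact this

lemma thT_ofReal {P : ℝ} (x : ℝ) :
    thT P (x : ℂ) = ((∑' m : ℤ, P ^ (m ^ 2) * x ^ m : ℝ) : ℂ) := by
  unfold thT
  rw [Complex.ofReal_tsum]
  push_cast
  rfl

lemma thT_summable_real {P : ℝ} (hP : 0 < P) (hP1 : P < 1) {x : ℝ} (hx : 0 < x) :
    Summable (fun m : ℤ => P ^ (m ^ 2) * x ^ m) := by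
  have := (thT_summable hP hP1 (z := (x : ℂ)) (by exact_mod_cast hx.ne')).norm
  simp_rw [thT_norm_term hP, Complex.norm_real, Real.norm_eq_abs, abs_of_pos hx] at this
  exact this

lemma thT_le_one {P : ℝ} (hP : 0 < P) (hP1 : P < 1) {w : ℂ} (hw : ‖w‖ = 1) :
    (thT P w).re ≤ (thT P 1).re := by
  have h := thT_norm_le hP hP1 (ne_zero_of_unit hw)
  rw [hw] at h
  have h1 := thT_ofReal (P := P) 1
  rw [Complex.ofReal_one] at h1
  rw [h1, Complex.ofReal_re, ← thT_norm hP hP1 hw]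
  exact h

lemma thT_P_le {P : ℝ} (hP : 0 < P) (hP1 : P < 1) :
    ‖thT P (P : ℂ)‖ ≤ 2 * (thT P 1).re := by
  have h := thT_norm_le hP hP1 (z := (P : ℂ)) (by exact_mod_cast hP.ne')
  rw [Complex.norm_real, Real.norm_eq_abs, abs_of_pos hP] at h
  have h1 := thT_ofReal (P := P) 1
  rw [Complex.ofReal_one] at h1
  rw [h1, Complex.ofReal_re]
  refine h.trans ?_
  have s1 : Summable (fun m : ℤ => P ^ (m ^ 2) * (1 : ℝ) ^ m) :=
    thT_summable_real hP hP1 one_pos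
  have s2 : Summable (fun m : ℤ => P ^ ((m + 1) ^ 2) * (1 : ℝ) ^ (m + 1)) :=
    (Equiv.addRight (1 : ℤ)).summable_iff.2 s1
  have e2 : ∑' m : ℤ, P ^ ((m + 1) ^ 2) * (1 : ℝ) ^ (m + 1) = ∑' m : ℤ, P ^ (m ^ 2) * (1 : ℝ) ^ m :=
    (Equiv.addRight (1 : ℤ)).tsum_eq (fun m : ℤ => P ^ (m ^ 2) * (1 : ℝ) ^ m)
  rw [two_mul]
  nth_rewrite 2 [← e2]
  rw [← s1.tsum_add s2]
  refine (thT_summable_real hP hP1 hP).tsum_le_tsum (fun m => ?_) (s1.add s2)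
  rw [← zpow_add₀ hP.ne', one_zpow, one_zpow, mul_one, mul_one]
  have p1 : 0 < P ^ (m ^ 2) := zpow_pos hP _
  have p2 : 0 < P ^ ((m + 1) ^ 2) := zpow_pos hP _
  rcases le_or_gt 0 m with hm | hm
  · have := zpow_le_zpow_right_of_le_one₀ hP hP1.le (show m ^ 2 ≤ m ^ 2 + m by omega)
    linarith
  · have := zpow_le_zpow_right_of_le_one₀ hP hP1.le (show (m + 1) ^ 2 ≤ m ^ 2 + m by nlinarith)
    linarith

lemma neg_zpow' (v : ℂ) (m : ℤ) : (-v) ^ m = (-1) ^ m * v ^ m := by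
  rw [← mul_zpow]; simp

lemma neg_one_zpow_inv (t : ℤ) : ((-1 : ℂ) ^ t)⁻¹ = (-1) ^ t := by
  rcases Int.even_or_odd t with h | h <;> simp [h.neg_one_zpow]

lemma neg_one_zpow_sq (t : ℤ) : ((-1 : ℂ) ^ t) ^ 2 = 1 := by
  rcases Int.even_or_odd t with h | h <;> simp [h.neg_one_zpow]

lemma hasSum_mul_aux {f g : ℤ → ℂ} (hf : Summable f) (hg : Summable g) :
    HasSum (fun x : ℤ × ℤ => f x.1 * g x.2) ((∑' m, f m) * ∑' m, g m) := by
  have h := summable_mul_of_summable_norm hf.norm hg.norm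
  exact HasSum.mul hf.hasSum hg.hasSum h

lemma th_mul_hasSum {P Q : ℝ} (hP : 0 < P) (hP1 : P < 1) (hQ : 0 < Q) (hQ1 : Q < 1) {z y : ℂ} (hz : z ≠ 0) (hy : y ≠ 0) :
    HasSum (fun x : ℤ × ℤ => ((P : ℂ) ^ (x.1 ^ 2) * z ^ x.1) * ((Q : ℂ) ^ (x.2 ^ 2) * y ^ x.2))
      (thT P z * thT Q y) :=
  hasSum_mul_aux (f := fun m : ℤ => (P : ℂ) ^ (m ^ 2) * z ^ m)
    (g := fun m : ℤ => (Q : ℂ) ^ (m ^ 2) * y ^ m)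
    (thT_summable hP hP1 hz) (thT_summable hQ hQ1 hy)

lemma th_quad_add {q : ℝ} (hq : 0 < q) (hq1 : q < 1) {w v : ℂ} (hw : w ≠ 0) (hv : v ≠ 0) :
    thT q w * thT q (-v) + thT q (-w) * thT q v =
      2 * (thT (q ^ 2) (-(w * v)) * thT (q ^ 2) (-(w / v))) := by
  have hP : 0 < q ^ 2 := by positivity
  have hP1 : q ^ 2 < 1 := by nlinarith
  have hqc : (q : ℂ) ≠ 0 := by exact_mod_cast hq.ne'
  have h1 := (th_mul_hasSum hq hq1 hq hq1 hw (neg_ne_zero.2 hv)).add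
    (th_mul_hasSum hq hq1 hq hq1 (neg_ne_zero.2 hw) hv)
  have h2 := (th_mul_hasSum hP hP1 hP hP1 (neg_ne_zero.2 (mul_ne_zero hw hv))
    (neg_ne_zero.2 (div_ne_zero hw hv))).mul_left 2
  have hinj : Function.Injective (fun x : ℤ × ℤ => (x.1 + x.2, x.1 - x.2)) := by
    rintro ⟨a, b⟩ ⟨c, d⟩ h
    simp only [Prod.mk.injEq] at h ⊢
    omega
  rw [← hinj.hasSum_iff] at h1
  · refine h1.unique (Eq.mp (congrArg (fun f => HasSum f _) (funext fun x => ?_)) h2)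
    obtain ⟨s, t⟩ := x
    simp only [Function.comp]
    rw [neg_zpow' v, neg_zpow' w, neg_zpow' (w * v), neg_zpow' (w / v)]
    have hq : (q : ℂ) ^ ((s + t) ^ 2) * (q : ℂ) ^ ((s - t) ^ 2) =
        ((q ^ 2 : ℝ) : ℂ) ^ (s ^ 2) * ((q ^ 2 : ℝ) : ℂ) ^ (t ^ 2) := by
      push_cast
      rw [← zpow_natCast (q : ℂ) 2, ← zpow_mul, ← zpow_mul, ← zpow_add₀ hqc, ← zpow_add₀ hqc]
      congr 1
      push_cast
      ring
    rw [zpow_sub₀ (show (-1 : ℂ) ≠ 0 by simp), zpow_add₀ (show (-1 : ℂ) ≠ 0 by simp),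
      div_eq_mul_inv ((-1 : ℂ) ^ s), neg_one_zpow_inv, zpow_add₀ hw, zpow_sub₀ hv, mul_zpow,
      div_zpow]
    linear_combination (-2 * (-1) ^ s * (-1) ^ t * w ^ s * w ^ t * (v ^ s / v ^ t)) * hq
  · rintro ⟨m, n⟩ hmn
    have hodd : ¬ Even (m + n) := by
      rintro ⟨r, hr⟩
      exact hmn ⟨(r, m - r), by simp; omega⟩
    simp only
    rw [neg_zpow' v, neg_zpow' w]
    have : (-1 : ℂ) ^ m + (-1) ^ n = 0 := by
      rw [Int.even_add] at hodd
      rcases Int.even_or_odd m with h | h <;> rcases Int.even_or_odd n with h' | h'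
      · tauto
      · simp [h.neg_one_zpow, h'.neg_one_zpow]
      · simp [h.neg_one_zpow, h'.neg_one_zpow]
      · rw [← Int.not_even_iff_odd] at h h'; tauto
    linear_combination ((q : ℂ) ^ (m ^ 2) * w ^ m * (q : ℂ) ^ (n ^ 2) * v ^ n) * this

lemma th_quad_sub {q : ℝ} (hq : 0 < q) (hq1 : q < 1) {w v : ℂ} (hw : w ≠ 0) (hv : v ≠ 0) :
    thT q w * thT q (-v) - thT q (-w) * thT q v =
      2 * q * w * (thT (q ^ 2) (-((q ^ 2 : ℝ) * (w * v))) * thT (q ^ 2) (-((q ^ 2 : ℝ) * (w / v)))) := by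
  have hP : 0 < q ^ 2 := by positivity
  have hP1 : q ^ 2 < 1 := by nlinarith
  have hqc : (q : ℂ) ≠ 0 := by exact_mod_cast hq.ne'
  have hPc : ((q ^ 2 : ℝ) : ℂ) ≠ 0 := by exact_mod_cast hP.ne'
  have h1 := (th_mul_hasSum hq hq1 hq hq1 hw (neg_ne_zero.2 hv)).sub
    (th_mul_hasSum hq hq1 hq hq1 (neg_ne_zero.2 hw) hv)
  have h2 := (th_mul_hasSum hP hP1 hP hP1 (neg_ne_zero.2 (mul_ne_zero hPc (mul_ne_zero hw hv)))
    (neg_ne_zero.2 (mul_ne_zero hPc (div_ne_zero hw hv)))).mul_left (2 * q * w)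
  have hinj : Function.Injective (fun x : ℤ × ℤ => (x.1 + x.2 + 1, x.1 - x.2)) := by
    rintro ⟨a, b⟩ ⟨c, d⟩ h
    simp only [Prod.mk.injEq] at h ⊢
    omega
  rw [← hinj.hasSum_iff] at h1
  · refine h1.unique (Eq.mp (congrArg (fun f => HasSum f _) (funext fun x => ?_)) h2)
    obtain ⟨s, t⟩ := x
    simp only [Function.comp]
    rw [neg_zpow' v, neg_zpow' w, neg_zpow' (_ * (w * v)), neg_zpow' (_ * (w / v))]
    have hq : (q : ℂ) ^ ((s + t + 1) ^ 2) * (q : ℂ) ^ ((s - t) ^ 2) =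
        q * (((q ^ 2 : ℝ) : ℂ) ^ (s ^ 2) * ((q ^ 2 : ℝ) : ℂ) ^ (t ^ 2)
          * (((q ^ 2 : ℝ) : ℂ) ^ s * ((q ^ 2 : ℝ) : ℂ) ^ t)) := by
      push_cast
      nth_rewrite 3 [← zpow_one (q : ℂ)]
      rw [← zpow_natCast (q : ℂ) 2]
      simp only [← zpow_mul, ← zpow_add₀ hqc]
      congr 1
      push_cast
      ring
    rw [zpow_sub₀ (show (-1 : ℂ) ≠ 0 by simp), zpow_add₀ (show (-1 : ℂ) ≠ 0 by simp),
      zpow_add₀ (show (-1 : ℂ) ≠ 0 by simp), zpow_one,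
      div_eq_mul_inv ((-1 : ℂ) ^ s), neg_one_zpow_inv, zpow_add₀ hw, zpow_add₀ hw, zpow_sub₀ hv,
      mul_zpow, mul_zpow, mul_zpow, div_zpow, zpow_one]
    linear_combination (-2 * (-1) ^ s * (-1) ^ t * w ^ s * w ^ t * w * (v ^ s / v ^ t)) * hq
  · rintro ⟨m, n⟩ hmn
    have heven : Even (m + n) := by
      by_contra h
      rw [Int.not_even_iff_odd] at h
      obtain ⟨r, hr⟩ := h
      exact hmn ⟨(r, m - r - 1), by simp; omega⟩
    simp only
    rw [neg_zpow' v, neg_zpow' w]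
    have : (-1 : ℂ) ^ n - (-1) ^ m = 0 := by
      rw [Int.even_add] at heven
      rcases Int.even_or_odd m with h | h <;> rcases Int.even_or_odd n with h' | h'
      · simp [h.neg_one_zpow, h'.neg_one_zpow]
      · rw [← Int.not_even_iff_odd] at h'; tauto
      · rw [← Int.not_even_iff_odd] at h; tauto
      · simp [h.neg_one_zpow, h'.neg_one_zpow]
    linear_combination ((q : ℂ) ^ (m ^ 2) * w ^ m * (q : ℂ) ^ (n ^ 2) * v ^ n) * this

noncomputable def thF (P : ℝ) (w : ℂ) : ℝ :=
  P ^ (1 / 4 : ℝ) * ‖thT P (-(P * w))‖ / ‖thT P (-w)‖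

noncomputable def phi (q : ℝ) (w : ℂ) : ℝ := (thT q w).re / (thT q (-w)).re

lemma phi_pos {q : ℝ} (hq : 0 < q) (hq1 : q < 1) {w : ℂ} (hw : ‖w‖ = 1) : 0 < phi q w :=
  div_pos (thT_pos hq hq1 hw) (thT_pos hq hq1 (by simpa using hw))

lemma phi_neg (q : ℝ) (w : ℂ) : phi q (-w) = (phi q w)⁻¹ := by
  simp [phi]

lemma phi_le {q : ℝ} (hq : 0 < q) (hq1 : q < 1) {w : ℂ} (hw : ‖w‖ = 1) : phi q w ≤ phi q 1 := by
  unfold phi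
  exact div_le_div₀ (thT_pos hq hq1 (by simp)).le (thT_le_one hq hq1 hw) (thT_neg_one_pos hq hq1)
    (thT_neg_one_le hq hq1 (by simpa using hw))

lemma quarter_sq {q : ℝ} (hq : 0 < q) : (q ^ 2) ^ (1 / 4 : ℝ) * (q ^ 2) ^ (1 / 4 : ℝ) = q := by
  rw [← Real.rpow_add (by positivity), ← Real.rpow_natCast q 2, ← Real.rpow_mul hq.le]
  norm_num

lemma thF_nonneg {P : ℝ} (hP : 0 < P) (w : ℂ) : 0 ≤ thF P w := by
  unfold thF; positivity

lemma phi_ratio {q : ℝ} (hq : 0 < q) (hq1 : q < 1) {w v : ℂ} (hw : ‖w‖ = 1) (hv : ‖v‖ = 1) :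
    |phi q w - phi q v| / (phi q w + phi q v) = thF (q ^ 2) (w * v) * thF (q ^ 2) (w / v) := by
  have hw0 := ne_zero_of_unit hw
  have hv0 := ne_zero_of_unit hv
  have hwn : ‖-w‖ = 1 := by simpa using hw
  have hvn : ‖-v‖ = 1 := by simpa using hv
  have hP : 0 < q ^ 2 := by positivity
  have hP1 : q ^ 2 < 1 := by nlinarith
  have h1 := th_quad_add hq hq1 hw0 hv0
  have h2 := th_quad_sub hq hq1 hw0 hv0
  have pa := thT_pos hq hq1 hw
  have pb := thT_pos hq hq1 hwn
  have pc := thT_pos hq hq1 hv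
  have pd := thT_pos hq hq1 hvn
  rw [thT_real hq hq1 hw, thT_real hq hq1 hwn, thT_real hq hq1 hv, thT_real hq hq1 hvn] at h1 h2
  have n1 := congrArg norm h1
  have n2 := congrArg norm h2
  unfold phi thF
  set a := (thT q w).re
  set b := (thT q (-w)).re
  set c := (thT q v).re
  set d := (thT q (-v)).re
  rw [show (a : ℂ) * d + b * c = ((a * d + b * c : ℝ) : ℂ) by push_cast; ring, Complex.norm_real,
    Real.norm_eq_abs, abs_of_pos (by positivity), norm_mul, norm_mul] at n1
  rw [show (a : ℂ) * d - b * c = ((a * d - b * c : ℝ) : ℂ) by push_cast; ring, Complex.norm_real,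
    Real.norm_eq_abs, norm_mul, norm_mul, norm_mul, norm_mul, hw, Complex.norm_real,
    Real.norm_eq_abs, abs_of_pos hq] at n2
  have e0 : |a / b - c / d| / (a / b + c / d) = |a * d - b * c| / (a * d + b * c) := by
    rw [div_sub_div _ _ pb.ne' pd.ne', div_add_div _ _ pb.ne' pd.ne', abs_div,
      abs_of_pos (show 0 < b * d by positivity)]
    field_simp
  rw [e0, n1, n2, div_mul_div_comm]
  simp only [Complex.norm_ofNat]
  rw [show ∀ x y z : ℝ, x * y * (x * z) = (x * x) * (y * z) by intros; ring, quarter_sq hq]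
  field_simp

lemma thF_le {P : ℝ} (hP : 0 < P) (hP1 : P < 1) {w : ℂ} (hw : ‖w‖ = 1) :
    thF P w ≤ 2 * P ^ (1 / 4 : ℝ) := by
  obtain ⟨q, hq, rfl⟩ : ∃ q : ℝ, 0 < q ∧ P = q ^ 2 :=
    ⟨√P, Real.sqrt_pos.2 hP, (Real.sq_sqrt hP.le).symm⟩
  have hq1 : q < 1 := by nlinarith
  have r1 := phi_ratio hq hq1 hw (v := 1) (by simp)
  have r2 := phi_ratio hq hq1 (w := -1) (by simp) (v := 1) (by simp)
  rw [mul_one, div_one] at r1 r2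
  have hle := phi_le hq hq1 hw
  have hle2 := phi_le hq hq1 (w := -w) (by simpa using hw)
  have p1 := phi_pos hq hq1 (w := 1) (by simp)
  have pw := phi_pos hq hq1 hw
  have hge : phi q (-1) ≤ phi q w := by
    rw [phi_neg] at hle2 ⊢
    exact (inv_le_comm₀ p1 pw).2 hle2
  have pm := phi_pos hq hq1 (w := -1) (by simp)
  have hF : thF (q ^ 2) w ≤ thF (q ^ 2) (-1) := by
    refine abs_le_of_sq_le_sq' ?_ (thF_nonneg hP _) |>.2
    rw [sq (thF _ _), sq (thF _ _), ← r1, ← r2, abs_sub_comm, abs_of_nonneg (by linarith), abs_sub_comm,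
      abs_of_nonneg (by linarith), div_le_div_iff₀ (by linarith) (by linarith)]
    nlinarith
  refine hF.trans ?_
  unfold thF
  rw [mul_neg_one, neg_neg, neg_neg, thT_norm hP hP1 (w := 1) (by simp),
    div_le_iff₀ (thT_pos hP hP1 (by simp))]
  have := thT_P_le hP hP1
  have h0 : 0 < (q ^ 2) ^ (1 / 4 : ℝ) := by positivity
  nlinarith

lemma prod_root {L : ℕ} (hL : 0 < L) {ζ : ℂ} (hζ : IsPrimitiveRoot ζ L) (y : ℂ) :
    ∏ j ∈ Finset.range L, (1 - ζ ^ j * y) = 1 - y ^ L := by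
  have := congrArg (Polynomial.eval 1) (X_pow_sub_C_eq_prod hζ hL (α := y) rfl)
  simp [Polynomial.eval_prod] at this
  exact this.symm

lemma thProd_root {P : ℝ} {L : ℕ} (hL : 0 < L) {ζ : ℂ} (hζ : IsPrimitiveRoot ζ L) (w : ℂ) (N : ℕ) :
    ∏ j ∈ Finset.range L, thProd P N (-(ζ ^ j * w)) = thProd (P ^ L) N (-(w ^ L)) := by
  unfold thProd
  rw [Finset.prod_comm]
  refine Finset.prod_congr rfl fun n _ => ?_
  rw [Finset.prod_mul_distrib]
  congr 1
  · have := prod_root hL hζ ((P : ℂ) ^ (2 * n + 1) * w)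
    convert this using 1
    · refine Finset.prod_congr rfl fun j _ => by ring
    · push_cast; ring
  · have := prod_root hL hζ.inv ((P : ℂ) ^ (2 * n + 1) * w⁻¹)
    convert this using 1
    · refine Finset.prod_congr rfl fun j _ => ?_
      rw [inv_neg, mul_inv, inv_pow]; ring
    · push_cast; rw [inv_neg, mul_pow, inv_pow]; ring

lemma thT_root {P : ℝ} (hP : 0 < P) (hP1 : P < 1) {L : ℕ} (hL : 0 < L) {ζ : ℂ} (hζ : IsPrimitiveRoot ζ L) :
    ∃ B : ℝ, 0 < B ∧ ∀ w : ℂ, w ≠ 0 →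
      ∏ j ∈ Finset.range L, thT P (-(ζ ^ j * w)) = B * thT (P ^ L) (-(w ^ L)) := by
  obtain ⟨A, hA, hlim⟩ := thProd_tendsto hP hP1
  obtain ⟨A', hA', hlim'⟩ := thProd_tendsto (pow_pos hP L) (pow_lt_one₀ hP.le hP1 hL.ne')
  refine ⟨A' / A ^ L, by positivity, fun w hw => ?_⟩
  have h1 := tendsto_finsetProd (Finset.range L) (fun j _ => hlim (-(ζ ^ j * w))
    (neg_ne_zero.2 (mul_ne_zero (pow_ne_zero _ (hζ.ne_zero hL.ne')) hw)))
  have h2 := hlim' (-(w ^ L)) (neg_ne_zero.2 (pow_ne_zero _ hw))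
  simp_rw [thProd_root hL hζ] at h1
  have h3 := tendsto_nhds_unique h1 h2
  rw [Finset.prod_mul_distrib, Finset.prod_const, Finset.card_range] at h3
  have : (A : ℂ) ≠ 0 := by exact_mod_cast hA.ne'
  push_cast
  field_simp
  linear_combination h3

lemma thF_root {P : ℝ} (hP : 0 < P) (hP1 : P < 1) {L : ℕ} (hL : 0 < L) {ζ : ℂ} (hζ : IsPrimitiveRoot ζ L)
    {w : ℂ} (hw : w ≠ 0) :
    ∏ j ∈ Finset.range L, thF P (ζ ^ j * w) = thF (P ^ L) (w ^ L) := by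
  obtain ⟨B, hB, h⟩ := thT_root hP hP1 hL hζ
  have hPc : (P : ℂ) ≠ 0 := by exact_mod_cast hP.ne'
  have h1 := congrArg norm (h w hw)
  have h2 := congrArg norm (h (P * w) (mul_ne_zero hPc hw))
  rw [norm_prod, norm_mul, Complex.norm_real, Real.norm_eq_abs, abs_of_pos hB] at h1 h2
  unfold thF
  rw [Finset.prod_div_distrib, Finset.prod_mul_distrib, Finset.prod_const, Finset.card_range, h1]
  have e : ∀ j : ℕ, (P : ℂ) * (ζ ^ j * w) = ζ ^ j * (P * w) := fun j => by ring
  simp_rw [e]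
  rw [h2, mul_pow]
  have : (P ^ (1 / 4 : ℝ)) ^ L = (P ^ L) ^ (1 / 4 : ℝ) := by
    rw [← Real.rpow_natCast, ← Real.rpow_natCast, ← Real.rpow_mul hP.le, ← Real.rpow_mul hP.le, mul_comm]
  rw [this]
  push_cast
  field_simp

lemma prod_fold (g : ℕ → ℝ) (l : ℕ) :
    ∏ j ∈ Finset.range l, (g j * g (2 * l - 1 - j)) = ∏ j ∈ Finset.range (2 * l), g j := by
  rw [Finset.prod_mul_distrib, two_mul, Finset.prod_range_add]
  congr 1
  rw [← Finset.prod_range_reflect]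
  refine Finset.prod_congr rfl fun j hj => ?_
  rw [Finset.mem_range] at hj
  congr 1
  omega

/-- product bound -/
lemma phi_prod {q : ℝ} (hq : 0 < q) (hq1 : q < 1) {l : ℕ} (hl : 1 ≤ l) :
    ∃ v : ℕ → ℂ, (∀ j, ‖v j‖ = 1) ∧ ∀ w : ℂ, ‖w‖ = 1 →
      ∏ j ∈ Finset.range l, (|phi q w - phi q (v j)| / (phi q w + phi q (v j))) ≤ 2 * q ^ l := by
  have hP : 0 < q ^ 2 := by positivity
  have hP1 : q ^ 2 < 1 := by nlinarith
  have hL : 0 < 2 * l := by omega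
  set η : ℂ := Complex.exp (2 * Real.pi * Complex.I / ((4 * l : ℕ) : ℂ)) with hη
  set ζ : ℂ := Complex.exp (2 * Real.pi * Complex.I / ((2 * l : ℕ) : ℂ)) with hζ
  have hprim : IsPrimitiveRoot ζ (2 * l) := Complex.isPrimitiveRoot_exp _ hL.ne'
  have hprim' : IsPrimitiveRoot η (4 * l) := Complex.isPrimitiveRoot_exp _ (by omega)
  have hηζ : η ^ 2 = ζ := by
    rw [hη, hζ, ← Complex.exp_nat_mul]
    congr 1
    have : (l : ℂ) ≠ 0 := by exact_mod_cast (by omega : l ≠ 0)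
    push_cast
    field_simp
    norm_num
  have nη : ‖η‖ = 1 := hprim'.norm'_eq_one (by omega)
  have nζ : ‖ζ‖ = 1 := hprim.norm'_eq_one (by omega)
  refine ⟨fun j => ζ ^ j * η, fun j => by simp [nη, nζ], fun w hw => ?_⟩
  have e : ∀ j ∈ Finset.range l, |phi q w - phi q (ζ ^ j * η)| / (phi q w + phi q (ζ ^ j * η)) =
      thF (q ^ 2) (ζ ^ j * (w * η)) * thF (q ^ 2) (ζ ^ (2 * l - 1 - j) * (w * η)) := by
    intro j hj
    rw [Finset.mem_range] at hj
    have hv0 : ζ ^ j * η ≠ 0 := ne_zero_of_unit (by simp [nη, nζ])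
    rw [phi_ratio hq hq1 hw (by simp [nη, nζ])]
    congr 2
    · ring
    · rw [div_eq_iff hv0]
      have : ζ ^ (2 * l - 1 - j) * ζ ^ j * ζ = 1 := by
        rw [← pow_add, ← pow_succ, show 2 * l - 1 - j + j + 1 = 2 * l by omega, hprim.pow_eq_one]
      linear_combination (-w) * this + (- ζ ^ (2 * l - 1 - j) * ζ ^ j * w) * hηζ
  rw [Finset.prod_congr rfl e, prod_fold (fun j => thF (q ^ 2) (ζ ^ j * (w * η))),
    thF_root hP hP1 hL hprim (mul_ne_zero (ne_zero_of_unit hw) (ne_zero_of_unit nη))]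
  have hb := thF_le (pow_pos hP (2 * l)) (pow_lt_one₀ hP.le hP1 hL.ne')
    (w := (w * η) ^ (2 * l)) (by simp [hw, nη])
  refine hb.trans (le_of_eq ?_)
  congr 1
  rw [← pow_mul, show 2 * (2 * l) = l * 4 by ring, pow_mul, ← Real.rpow_natCast (q ^ l) 4,
    ← Real.rpow_mul (by positivity)]
  norm_num

lemma phi_one_ge {H : ℝ} (hH : 0 < H) :
    Real.exp H / 4 ≤ phi (Real.exp (-(Real.pi ^ 2 / (2 * H)))) 1 ^ 2 := by
  set q := Real.exp (-(Real.pi ^ 2 / (2 * H))) with hqd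
  have hpi := Real.pi_pos
  have hq : 0 < q := Real.exp_pos _
  have hq1 : q < 1 := by
    rw [hqd, Real.exp_lt_one_iff]
    have : 0 < Real.pi ^ 2 / (2 * H) := by positivity
    linarith
  set r := Real.exp (-(2 * H)) with hrd
  have hr : 0 < r := Real.exp_pos _
  have hr1 : r < 1 := by rw [hrd, Real.exp_lt_one_iff]; linarith
  have hpic : (Real.pi : ℂ) ≠ 0 := by exact_mod_cast hpi.ne'
  have hHc : (H : ℂ) ≠ 0 := by exact_mod_cast hH.ne'
  set τ : ℂ := Complex.I * ((Real.pi / (2 * H) : ℝ) : ℂ) with hτ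
  have hτ0 : τ ≠ 0 := by
    rw [hτ]; push_cast
    exact mul_ne_zero Complex.I_ne_zero (div_ne_zero hpic (mul_ne_zero two_ne_zero hHc))
  have tq : Complex.I * ((-Real.log q / Real.pi : ℝ) : ℂ) = τ := by
    rw [hqd, Real.log_exp, hτ]
    congr 2
    field_simp
  have tr : Complex.I * ((-Real.log r / Real.pi : ℝ) : ℂ) = -1 / τ := by
    rw [hrd, Real.log_exp, hτ]
    push_cast
    field_simp
    simp
  have q1 : thT q 1 = jacobiTheta₂ 0 τ := by
    rw [← tq, ← thT_eq_jacobi hq]; simp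
  have q2 : thT q (-1) = jacobiTheta₂ (1 / 2) τ := by
    rw [← tq, ← thT_eq_jacobi hq]
    congr 1
    rw [show 2 * (Real.pi : ℂ) * Complex.I * (1 / 2) = Real.pi * Complex.I by ring, Complex.exp_pi_mul_I]
  have r1 : thT r 1 = jacobiTheta₂ 0 (-1 / τ) := by
    rw [← tr, ← thT_eq_jacobi hr]; simp
  have r2 : thT r (r : ℂ) = jacobiTheta₂ (1 / 2 / τ) (-1 / τ) := by
    rw [← jacobiTheta₂_neg_left, ← tr, ← thT_eq_jacobi hr]
    congr 1
    rw [hrd, Complex.ofReal_exp]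
    congr 1
    rw [hτ]
    push_cast
    field_simp
  rw [jacobiTheta₂_functional_equation] at q1 q2
  rw [zero_div, ← r1] at q1
  rw [← r2] at q2
  have n1 := congrArg norm q1
  have n2 := congrArg norm q2
  have ex : Complex.exp (-Real.pi * Complex.I * (1 / 2) ^ 2 / τ) = ((Real.exp (-(H / 2)) : ℝ) : ℂ) := by
    rw [Complex.ofReal_exp]
    congr 1
    rw [hτ]
    push_cast
    field_simp
  rw [thT_norm hq hq1 (by simp), norm_mul, norm_mul, thT_norm hr hr1 (by simp)] at n1
  rw [ex, thT_norm hq hq1 (by simp), norm_mul, norm_mul, Complex.norm_real, Real.norm_eq_abs,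
    abs_of_pos (Real.exp_pos _)] at n2
  simp at n1
  have hle := thT_P_le hr hr1
  have pm := thT_neg_one_pos hq hq1
  have key : (thT q (-1)).re ≤ 2 * Real.exp (-(H / 2)) * (thT q 1).re := by
    rw [n1, n2]
    simp only [one_div, norm_inv]
    have h0 : 0 ≤ ‖(-Complex.I * τ) ^ (2⁻¹ : ℂ)‖⁻¹ * Real.exp (-(H / 2)) := by positivity
    have := mul_le_mul_of_nonneg_left hle h0
    simp only [neg_mul] at this ⊢
    linarith
  have : Real.exp (H / 2) / 2 ≤ phi q 1 := by
    unfold phi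
    rw [le_div_iff₀ pm]
    have e : Real.exp (H / 2) * Real.exp (-(H / 2)) = 1 := by rw [← Real.exp_add]; simp
    have := mul_le_mul_of_nonneg_left key (Real.exp_pos (H / 2)).le
    have e2 : Real.exp (H / 2) * (2 * Real.exp (-(H / 2)) * (thT q 1).re) = 2 * (thT q 1).re := by
      linear_combination (2 * (thT q 1).re) * e
    linarith
  calc Real.exp H / 4 = (Real.exp (H / 2) / 2) ^ 2 := by
        rw [div_pow, ← Real.exp_nat_mul]; norm_num; congr 1; ring
    _ ≤ _ := pow_le_pow_left₀ (by positivity) this 2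

lemma phi_cover {q : ℝ} (hq : 0 < q) (hq1 : q < 1) {y : ℝ} (h1 : phi q (-1) ≤ y) (h2 : y ≤ phi q 1) :
    ∃ w : ℂ, ‖w‖ = 1 ∧ phi q w = y := by
  set e : ℝ → ℂ := fun t => Complex.exp (2 * Real.pi * Complex.I * t) with he
  have ne : ∀ t, ‖e t‖ = 1 := fun t => by
    rw [he]
    simp only
    rw [show 2 * (Real.pi : ℂ) * Complex.I * t = ((2 * Real.pi * t : ℝ) : ℂ) * Complex.I by push_cast; ring]
    exact Complex.norm_exp_ofReal_mul_I _
  have nge : ∀ t : ℝ, -e t = Complex.exp (2 * Real.pi * Complex.I * (t + 1 / 2)) := fun t => by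
    rw [mul_add, Complex.exp_add, show 2 * (Real.pi : ℂ) * Complex.I * (1 / 2) = Real.pi * Complex.I by ring, Complex.exp_pi_mul_I]
    simp [he]
  have hc : Continuous (fun z : ℂ => jacobiTheta₂ z (Complex.I * ((-Real.log q / Real.pi : ℝ) : ℂ))) :=
    continuous_iff_continuousAt.2 fun z =>
      (differentiableAt_jacobiTheta₂_fst z (thT_tau_im hq hq1)).continuousAt
  have c1 : Continuous (fun t => (thT q (e t)).re) := by
    simp only [he, thT_eq_jacobi hq]
    exact Complex.continuous_re.comp (hc.comp Complex.continuous_ofReal)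
  have c2 : Continuous (fun t => (thT q (-e t)).re) := by
    simp only [nge, thT_eq_jacobi hq]
    exact Complex.continuous_re.comp (hc.comp (Complex.continuous_ofReal.add continuous_const))
  have c3 : Continuous (fun t => phi q (e t)) :=
    c1.div c2 fun t => (thT_pos hq hq1 (by rw [norm_neg]; exact ne t)).ne'
  have hiv := intermediate_value_Icc' (f := fun t => phi q (e t)) (a := 0) (b := 1 / 2) (by norm_num) c3.continuousOn
  have e0 : e 0 = 1 := by simp [he]
  have e1 : e (1 / 2) = -1 := by
    have := nge 0
    rw [e0] at this
    rw [this, he]; simp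
  obtain ⟨t, -, ht⟩ := hiv (show y ∈ _ by simp only [e0, e1]; exact ⟨h1, h2⟩)
  exact ⟨e t, ne t, ht⟩

theorem zolo {a b : ℝ} (ha : 0 < a) (hab : a ≤ b) {l : ℕ} (hl : 1 ≤ l) :
    ∃ τ : ℕ → ℝ, (∀ j, 0 < τ j) ∧ ∀ x, a ≤ x → x ≤ b →
      |∏ j ∈ Finset.range l, ((x - τ j) / (x + τ j))| ≤
        2 * Real.exp (-(Real.pi ^ 2 / (2 * Real.log (4 * (b / a))))) ^ l := by
  have hk : 1 ≤ b / a := (one_le_div ha).2 hab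
  have hH : 0 < Real.log (4 * (b / a)) := Real.log_pos (by linarith)
  have hge := phi_one_ge hH
  rw [Real.exp_log (by linarith)] at hge
  set q := Real.exp (-(Real.pi ^ 2 / (2 * Real.log (4 * (b / a))))) with hqd
  have hq : 0 < q := Real.exp_pos _
  have hq1 : q < 1 := by
    rw [hqd, Real.exp_lt_one_iff]
    have := Real.pi_pos
    have : 0 < Real.pi ^ 2 / (2 * Real.log (4 * (b / a))) := by positivity
    linarith
  obtain ⟨v, hv, hprod⟩ := phi_prod hq hq1 hl
  have p1 := phi_pos hq hq1 (w := 1) (by simp)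
  set μ := a * phi q 1 with hμ
  have hμ0 : 0 < μ := by positivity
  refine ⟨fun j => μ * phi q (v j), fun j => mul_pos hμ0 (phi_pos hq hq1 (hv j)), fun x hx hx' => ?_⟩
  obtain ⟨w, hw, hwx⟩ := phi_cover hq hq1 (y := x / μ) (by
      rw [phi_neg, le_div_iff₀ hμ0, hμ]; field_simp; exact hx) (by
      rw [div_le_iff₀ hμ0, hμ]
      have h3 : b / a ≤ phi q 1 ^ 2 := by linarith
      rw [div_le_iff₀ ha] at h3
      nlinarith)
  have hxw : x = μ * phi q w := by rw [hwx]; field_simp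
  have pw := phi_pos hq hq1 hw
  refine le_trans (le_of_eq ?_) (hprod w hw)
  rw [Finset.abs_prod]
  refine Finset.prod_congr rfl fun j _ => ?_
  have pv := phi_pos hq hq1 (hv j)
  rw [hxw, ← mul_sub, ← mul_add, mul_div_mul_left _ _ hμ0.ne', abs_div, abs_of_pos (add_pos pw pv)]

end ThetaPart

open Matrix

lemma rank_add_le_aux {n : ℕ} (A B : Matrix (Fin n) (Fin n) ℝ) : (A + B).rank ≤ A.rank + B.rank := by
  unfold Matrix.rank
  have h : LinearMap.range (A + B).mulVecLin ≤
      LinearMap.range A.mulVecLin ⊔ LinearMap.range B.mulVecLin := by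
    rintro _ ⟨x, rfl⟩
    rw [Matrix.mulVecLin_add]
    exact Submodule.add_mem_sup ⟨x, rfl⟩ ⟨x, rfl⟩
  exact (Submodule.finrank_mono h).trans (Submodule.finrank_add_le_finrank_add_finrank _ _)

lemma adi_step {n k : ℕ} (d : Fin n → ℝ) (hd : ∀ i, 0 < d i) (τ : ℝ) (hτ : 0 < τ)
    (X : Matrix (Fin n) (Fin n) ℝ) (hX : (diagonal d * X + X * diagonal d).rank ≤ k) :
    (X - diagonal (fun i => (d i - τ) / (d i + τ)) * X *
      diagonal (fun i => (d i - τ) / (d i + τ))).rank ≤ k := by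
  have e : X - diagonal (fun i => (d i - τ) / (d i + τ)) * X *
      diagonal (fun i => (d i - τ) / (d i + τ)) =
      diagonal (fun i => 2 * τ / (d i + τ)) * (diagonal d * X + X * diagonal d) *
        diagonal (fun i => 1 / (d i + τ)) := by
    ext i j
    simp only [Matrix.sub_apply, mul_diagonal, diagonal_mul, Matrix.add_apply]
    have h1 : d i + τ ≠ 0 := (add_pos (hd i) hτ).ne'
    have h2 : d j + τ ≠ 0 := (add_pos (hd j) hτ).ne'
    field_simp
    ring
  rw [e]
  exact (rank_mul_le_left _ _).trans ((rank_mul_le_right _ _).trans hX)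

lemma adi {n k : ℕ} (d : Fin n → ℝ) (hd : ∀ i, 0 < d i) (τ : ℕ → ℝ) (hτ : ∀ j, 0 < τ j)
    (X : Matrix (Fin n) (Fin n) ℝ) (hX : (diagonal d * X + X * diagonal d).rank ≤ k) (l : ℕ) :
    (X - diagonal (fun i => ∏ j ∈ Finset.range l, ((d i - τ j) / (d i + τ j))) * X *
      diagonal (fun i => ∏ j ∈ Finset.range l, ((d i - τ j) / (d i + τ j)))).rank ≤ k * l := by
  induction l with
  | zero => simp
  | succ l ih =>
    set g := fun i => ∏ j ∈ Finset.range l, ((d i - τ j) / (d i + τ j)) with hg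
    have hr : (diagonal d * (diagonal g * X * diagonal g) +
        (diagonal g * X * diagonal g) * diagonal d).rank ≤ k := by
      have e : diagonal d * (diagonal g * X * diagonal g) +
        (diagonal g * X * diagonal g) * diagonal d =
        diagonal g * (diagonal d * X + X * diagonal d) * diagonal g := by
        ext i j
        simp only [mul_diagonal, diagonal_mul, Matrix.add_apply]
        ring
      rw [e]
      exact (rank_mul_le_left _ _).trans ((rank_mul_le_right _ _).trans hX)
    have hs := adi_step d hd (τ l) (hτ l) _ hr
    have e2 : X - diagonal (fun i => ∏ j ∈ Finset.range (l + 1), ((d i - τ j) / (d i + τ j))) * X *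
      diagonal (fun i => ∏ j ∈ Finset.range (l + 1), ((d i - τ j) / (d i + τ j))) =
      (X - diagonal g * X * diagonal g) + (diagonal g * X * diagonal g -
        diagonal (fun i => (d i - τ l) / (d i + τ l)) * (diagonal g * X * diagonal g) *
          diagonal (fun i => (d i - τ l) / (d i + τ l))) := by
      ext i j
      simp only [Matrix.sub_apply, mul_diagonal, diagonal_mul, Matrix.add_apply, Finset.prod_range_succ, hg]
      ring
    rw [e2]
    refine (rank_add_le_aux _ _).trans ?_
    rw [mul_add, mul_one]
    exact add_le_add ih hs

open scoped Matrix.Norms.L2Operator in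
lemma specNorm_eq {n : ℕ} (M : Matrix (Fin n) (Fin n) ℝ) : specNorm M = ‖M‖ := by
  rw [Matrix.l2_opNorm_def]; rfl

open scoped Matrix.Norms.L2Operator in
lemma specNorm_bound {n : ℕ} (U : unitary (Matrix (Fin n) (Fin n) ℝ)) (g : Fin n → ℝ) {B : ℝ} (hB : 0 ≤ B)
    (hg : ∀ i, |g i| ≤ B) (Y : Matrix (Fin n) (Fin n) ℝ) :
    specNorm ((U : Matrix (Fin n) (Fin n) ℝ) * (diagonal g * Y * diagonal g) * star (U : Matrix (Fin n) (Fin n) ℝ)) ≤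
      B ^ 2 * specNorm ((U : Matrix (Fin n) (Fin n) ℝ) * Y * star (U : Matrix (Fin n) (Fin n) ℝ)) := by
  have hs : star (U : Matrix (Fin n) (Fin n) ℝ) = ((star U : unitary (Matrix (Fin n) (Fin n) ℝ)) : Matrix (Fin n) (Fin n) ℝ) := rfl
  rw [specNorm_eq, specNorm_eq, hs, CStarRing.norm_mul_coe_unitary, CStarRing.norm_coe_unitary_mul,
    CStarRing.norm_mul_coe_unitary, CStarRing.norm_coe_unitary_mul]
  have hd : ‖diagonal g‖ ≤ B := by
    rw [Matrix.l2_opNorm_diagonal]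
    exact (pi_norm_le_iff_of_nonneg hB).2 hg
  calc ‖diagonal g * Y * diagonal g‖ ≤ ‖diagonal g‖ * ‖Y‖ * ‖diagonal g‖ :=
        (norm_mul_le _ _).trans (mul_le_mul_of_nonneg_right (norm_mul_le _ _) (norm_nonneg _))
    _ ≤ B * ‖Y‖ * B := by gcongr
    _ = _ := by ring

/-- **Low-rank approximability of solutions of SPD Lyapunov equations.**
If `A` is symmetric positive definite with condition number `κ_A = λ_max / λ_min`, and
`AX + XA = C` with `rank C ≤ k`, then with `ρ = exp(π² / (2 log(4 κ_A)))`, for every `ℓ ≥ 1`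
there is a matrix `M` of rank at most `k·ℓ` with `‖X - M‖₂ ≤ 4 ρ^(-2ℓ) ‖X‖₂`. -/
theorem lyapunov_spd_low_rank_approx
    {n k : ℕ} (A C X : Matrix (Fin n) (Fin n) ℝ)
    (hA : A.PosDef)
    (κA : ℝ) (hκ : κA = sSup (spectrum ℝ A) / sInf (spectrum ℝ A))
    (hX : A * X + X * A = C) (hC : C.rank ≤ k)
    (ρ : ℝ) (hρ : ρ = Real.exp (Real.pi ^ 2 / (2 * Real.log (4 * κA)))) :
    ∀ ℓ : ℕ, 1 ≤ ℓ →
      ∃ M : Matrix (Fin n) (Fin n) ℝ, M.rank ≤ k * ℓ ∧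
        specNorm (X - M) ≤ 4 * ρ ^ (-(2 * (ℓ : ℤ))) * specNorm X := by
  intro l hl
  rcases Nat.eq_zero_or_pos n with rfl | hn
  · refine ⟨0, by simp, ?_⟩
    have : specNorm X = 0 := by
      rw [Subsingleton.elim X 0]; simp [specNorm]
    rw [Subsingleton.elim (X - 0) X, this, mul_zero]
  haveI : Nonempty (Fin n) := ⟨⟨0, hn⟩⟩
  have hH := hA.isHermitian
  set d := hH.eigenvalues with hd
  have hdpos : ∀ i, 0 < d i := hA.eigenvalues_pos
  have hspec : spectrum ℝ A = Set.range d := hH.spectrum_real_eq_range_eigenvalues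
  have hfin : (Set.range d).Finite := Set.finite_range d
  have hne : (Set.range d).Nonempty := Set.range_nonempty d
  rw [hspec] at hκ
  set a := sInf (Set.range d) with ha
  set b := sSup (Set.range d) with hb
  have ha0 : 0 < a := by
    obtain ⟨i, hi⟩ := hne.csInf_mem hfin
    rw [ha, ← hi]; exact hdpos i
  have hda : ∀ i, a ≤ d i := fun i => csInf_le hfin.bddBelow ⟨i, rfl⟩
  have hdb : ∀ i, d i ≤ b := fun i => le_csSup hfin.bddAbove ⟨i, rfl⟩
  have hab : a ≤ b := (hda ⟨0, hn⟩).trans (hdb ⟨0, hn⟩)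
  obtain ⟨τ, hτ, hz⟩ := zolo ha0 hab hl
  set U : unitary (Matrix (Fin n) (Fin n) ℝ) := hH.eigenvectorUnitary with hU
  set V : Matrix (Fin n) (Fin n) ℝ := (U : Matrix (Fin n) (Fin n) ℝ) with hV
  have hVV : star V * V = 1 := Unitary.coe_star_mul_self U
  have hVV' : V * star V = 1 := Unitary.coe_mul_star_self U
  have hAd : A = V * diagonal d * star V := by
    have := hH.spectral_theorem
    rw [Unitary.conjStarAlgAut_apply] at this
    exact this
  set Y := star V * X * V with hY
  have hXY : X = V * Y * star V := by
    rw [hY]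
    calc X = 1 * X * 1 := by simp
      _ = _ := by rw [← hVV']; simp only [mul_assoc]
  have hYr : (diagonal d * Y + Y * diagonal d).rank ≤ k := by
    have e : diagonal d * Y + Y * diagonal d = star V * C * V := by
      rw [← hX, hAd, hY]
      have : ∀ Z : Matrix (Fin n) (Fin n) ℝ, star V * (V * Z) = Z := fun Z => by
        rw [← mul_assoc, hVV, one_mul]
      simp only [mul_add, add_mul, mul_assoc, this, hVV, mul_one]
    rw [e]
    exact (rank_mul_le_left _ _).trans ((rank_mul_le_right _ _).trans hC)
  have hr := adi d hdpos τ hτ Y hYr l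
  set g := fun i => ∏ j ∈ Finset.range l, ((d i - τ j) / (d i + τ j)) with hg
  refine ⟨V * (Y - diagonal g * Y * diagonal g) * star V,
    (rank_mul_le_left _ _).trans ((rank_mul_le_right _ _).trans hr), ?_⟩
  have e3 : X - V * (Y - diagonal g * Y * diagonal g) * star V =
      V * (diagonal g * Y * diagonal g) * star V := by
    conv_lhs => rw [hXY]
    rw [mul_sub, sub_mul]
    abel
  rw [e3]
  rw [← hκ] at hz
  have hb := specNorm_bound U g (B := 2 * Real.exp (-(Real.pi ^ 2 / (2 * Real.log (4 * κA)))) ^ l)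
    (by positivity) (fun i => hz (d i) (hda i) (hdb i)) Y
  rw [← hV, ← hXY] at hb
  refine hb.trans (le_of_eq ?_)
  congr 1
  rw [Real.exp_neg, ← hρ, _root_.zpow_neg, show (2 * (l : ℤ)) = ((2 * l : ℕ) : ℤ) by push_cast; ring,
    _root_.zpow_natCast, mul_pow, inv_pow, inv_pow, ← pow_mul, mul_comm l 2]
  norm_num
end

section
/- Let A, B, C, X be n×n matrices partitioned conformally into 2×2 blocks (with square diagonal blocks of sizes p and n−p), and suppose AX + XB = C. Then the (2,1) block of X satisfies the Sylvester equation A₂₂·X₂₁ + X₂₁·B₁₁ = C₂₁ − A₂₁·X₁₁ − X₂₂·B₂₁. Moreover, if A has quasiseparable rank at most k_A, B has quasiseparable rank at most k_B, and C has quasiseparable rank at most k_C, then the right-hand side C₂₁ − A₂₁·X₁₁ − X₂₂·B₂₁ has rank at most k_A + k_B + k_C. -/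
open Matrix

/-- `A` has lower quasiseparable rank at most `k`: every submatrix contained entirely in the
strictly lower triangular part has rank at most `k`. -/
def LowerQSRankLE {𝕜 : Type*} [Field 𝕜] {n : ℕ} (A : Matrix (Fin n) (Fin n) 𝕜) (k : ℕ) : Prop :=
  ∀ (u v : ℕ) (r : Fin u → Fin n) (c : Fin v → Fin n),
    (∀ i j, (c j : ℕ) < (r i : ℕ)) → (A.submatrix r c).rank ≤ k

/-- `A` has upper quasiseparable rank at most `k`: every submatrix contained entirely in the
strictly upper triangular part has rank at most `k`. -/
def UpperQSRankLE {𝕜 : Type*} [Field 𝕜] {n : ℕ} (A : Matrix (Fin n) (Fin n) 𝕜) (k : ℕ) : Prop :=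
  ∀ (u v : ℕ) (r : Fin u → Fin n) (c : Fin v → Fin n),
    (∀ i j, (r i : ℕ) < (c j : ℕ)) → (A.submatrix r c).rank ≤ k

/-- `A` has quasiseparable rank at most `k`. -/
def QSRankLE {𝕜 : Type*} [Field 𝕜] {n : ℕ} (A : Matrix (Fin n) (Fin n) 𝕜) (k : ℕ) : Prop :=
  LowerQSRankLE A k ∧ UpperQSRankLE A k

/-- Reindex a matrix indexed by `Fin p ⊕ Fin q` as an ordinary square matrix indexed by
`Fin (p + q)`, with the first summand mapped to the indices `0, …, p-1` and the second to
`p, …, p+q-1`. -/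
def toSq {α : Type*} {p q : ℕ} (M : Matrix (Fin p ⊕ Fin q) (Fin p ⊕ Fin q) α) :
    Matrix (Fin (p + q)) (Fin (p + q)) α :=
  M.submatrix finSumFinEquiv.symm finSumFinEquiv.symm

/-- Subadditivity of the rank. -/
theorem matrix_rank_add_le_aux {p q : ℕ} (M N : Matrix (Fin q) (Fin p) ℝ) :
    (M + N).rank ≤ M.rank + N.rank := by
  unfold Matrix.rank
  refine le_trans (Submodule.finrank_mono (t := LinearMap.range M.mulVecLin ⊔
    LinearMap.range N.mulVecLin) ?_) (Submodule.finrank_add_le_finrank_add_finrank _ _)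
  rintro _ ⟨x, rfl⟩
  rw [Matrix.mulVecLin_add, LinearMap.add_apply]
  exact Submodule.add_mem_sup ⟨x, rfl⟩ ⟨x, rfl⟩

/-- The `(2,1)` block has rank bounded by the quasiseparable rank. -/
theorem rank_block21_le {p q k : ℕ}
    (M11 : Matrix (Fin p) (Fin p) ℝ) (M12 : Matrix (Fin p) (Fin q) ℝ)
    (M21 : Matrix (Fin q) (Fin p) ℝ) (M22 : Matrix (Fin q) (Fin q) ℝ)
    (h : QSRankLE (toSq (fromBlocks M11 M12 M21 M22)) k) : M21.rank ≤ k := by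
  have h1 := h.1 q p (Fin.natAdd p) (Fin.castAdd q) (by
    intro i j
    simp only [Fin.val_castAdd, Fin.val_natAdd]
    omega)
  have h2 : (toSq (fromBlocks M11 M12 M21 M22)).submatrix (Fin.natAdd p) (Fin.castAdd q)
      = M21 := by
    ext i j
    simp [toSq]
  rwa [h2] at h1

/-- **The Sylvester equation satisfied by the lower-left block of the solution.**
If `AX + XB = C` in a conformal `2×2` block partition, then
`A₂₂ X₂₁ + X₂₁ B₁₁ = C₂₁ - A₂₁ X₁₁ - X₂₂ B₂₁`, and if `A`, `B`, `C` have quasiseparable ranks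
at most `k_A`, `k_B`, `k_C`, the right-hand side has rank at most `k_A + k_B + k_C`. -/
theorem sylvester_block21_equation_and_rank
    {p q kA kB kC : ℕ}
    (A11 B11 C11 X11 : Matrix (Fin p) (Fin p) ℝ)
    (A12 B12 C12 X12 : Matrix (Fin p) (Fin q) ℝ)
    (A21 B21 C21 X21 : Matrix (Fin q) (Fin p) ℝ)
    (A22 B22 C22 X22 : Matrix (Fin q) (Fin q) ℝ)
    (hX : fromBlocks A11 A12 A21 A22 * fromBlocks X11 X12 X21 X22 +
          fromBlocks X11 X12 X21 X22 * fromBlocks B11 B12 B21 B22 =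
          fromBlocks C11 C12 C21 C22) :
    A22 * X21 + X21 * B11 = C21 - A21 * X11 - X22 * B21 ∧
    (QSRankLE (toSq (fromBlocks A11 A12 A21 A22)) kA →
      QSRankLE (toSq (fromBlocks B11 B12 B21 B22)) kB →
      QSRankLE (toSq (fromBlocks C11 C12 C21 C22)) kC →
      (C21 - A21 * X11 - X22 * B21).rank ≤ kA + kB + kC) := by
  constructor
  · rw [fromBlocks_multiply, fromBlocks_multiply, fromBlocks_add, fromBlocks_inj] at hX
    rw [← hX.2.2.1]
    abel
  · intro hA hB hC
    have a := rank_block21_le _ _ _ _ hA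
    have b := rank_block21_le _ _ _ _ hB
    have c := rank_block21_le _ _ _ _ hC
    have e : C21 - A21 * X11 - X22 * B21 = C21 + A21 * (-X11) + (-X22) * B21 := by
      rw [Matrix.mul_neg, Matrix.neg_mul]
      abel
    rw [e]
    have h1 := matrix_rank_add_le_aux (C21 + A21 * (-X11)) ((-X22) * B21)
    have h2 := matrix_rank_add_le_aux C21 (A21 * (-X11))
    have h3 := Matrix.rank_mul_le_left A21 (-X11)
    have h4 := Matrix.rank_mul_le_right (-X22) B21
    omega
end
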